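/- arXiv:1811.05919 — 12 statements merged into one kernel-verified Lean document; each statement's English description precedes it below -/
import Mathlib

section
/- For integers r ≥ 1 and s ≥ 1, the set LS_n(r,s) of n×n real matrices is not closed (in the Euclidean topology on ℝ^{n×n}) provided (r+1)(s+2) ≤ n; moreover, when s is of the form s = p²·r for some integer p ≥ 1, LS_n(r,s) is not closed provided (r+2)^{3/2}·s^{1/2} ≤ n. -/
open Matrix

/-- The number of nonzero entries of a matrix (the "ℓ₀ norm"). -/
noncomputable def sparsity {I J : Type*} [Fintype I] [Fintype J] (S : Matrix I J ℝ) : ℕ :=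
  Nat.card {p : I × J // S p.1 p.2 ≠ 0}

/-- The set of `m × n` real matrices expressible as a rank `≤ r` matrix plus a
matrix with at most `s` nonzero entries. -/
def LS (m n r s : ℕ) : Set (Matrix (Fin m) (Fin n) ℝ) :=
  {M | ∃ L S : Matrix (Fin m) (Fin n) ℝ, M = L + S ∧ L.rank ≤ r ∧ sparsity S ≤ s}

/-- The matrix rigidity: minimal number of entries that must be changed to reduce
the rank to at most `r`. -/
noncomputable def Rig {I J : Type*} [Fintype I] [Fintype J] (M : Matrix I J ℝ) (r : ℕ) : ℕ :=
  sInf {k | ∃ S : Matrix I J ℝ, (M - S).rank ≤ r ∧ sparsity S = k}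

/-- The Frobenius norm of a matrix. -/
noncomputable def frobNorm {I J : Type*} [Fintype I] [Fintype J] (A : Matrix I J ℝ) : ℝ :=
  Real.sqrt (∑ i, ∑ j, (A i j) ^ 2)


/-- Indicator of the indices `k ≥ a` with `k - a ≡ c` modulo `r`. -/
def residueIndicator (a r c k : ℕ) : ℝ := if a ≤ k ∧ (k - a) % r = c then 1 else 0

/-- Indicator of the indices `k < a`. -/
def initialIndicator (a k : ℕ) : ℝ := if k < a then 1 else 0

/-- A matrix which, up to a multiple of the indicator of its leading `a × a` block,
is a limit of matrices of rank at most `r + 1`. -/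
def spikeLimit (n a r : ℕ) : Matrix (Fin n) (Fin n) ℝ := fun k l =>
  initialIndicator a k * residueIndicator a (r + 1) 0 l
    + residueIndicator a (r + 1) 0 k * initialIndicator a l
    + ∑ c : Fin r, residueIndicator a (r + 1) (c + 1) k * residueIndicator a (r + 1) (c + 1) l

lemma sparsity_le_of_support_lt {n : ℕ} (a : ℕ) (S : Matrix (Fin n) (Fin n) ℝ)
    (hS : ∀ k l, S k l ≠ 0 → (k : ℕ) < a ∧ (l : ℕ) < a) : sparsity S ≤ a ^ 2 := by
  let f : {p : Fin n × Fin n // S p.1 p.2 ≠ 0} → Fin a × Fin a := fun p =>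
    (⟨p.1.1, (hS _ _ p.2).1⟩, ⟨p.1.2, (hS _ _ p.2).2⟩)
  have hf : Function.Injective f := by
    rintro ⟨⟨k, l⟩, h⟩ ⟨⟨k', l'⟩, h'⟩ e
    simp only [f, Prod.mk.injEq, Fin.mk.injEq] at e
    simp only [Subtype.mk.injEq, Prod.mk.injEq]
    exact ⟨Fin.ext e.1, Fin.ext e.2⟩
  have := Nat.card_le_card_of_injective f hf
  simpa [sparsity, sq] using this

lemma spikeLimit_add_mem_LS (n a r s : ℕ) (ha : a ^ 2 ≤ s) {ε : ℝ} (hε : ε ≠ 0) :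
    (fun k l => spikeLimit n a r k l
      + ε * (residueIndicator a (r + 1) 0 k * residueIndicator a (r + 1) 0 l))
      ∈ LS n n (r + 1) s := by
  let A : Matrix (Fin n) (Fin (r + 1)) ℝ := fun k => Fin.cons
    (ε⁻¹ * initialIndicator a k + residueIndicator a (r + 1) 0 k)
    (fun c : Fin r => residueIndicator a (r + 1) (c + 1) k)
  let B : Matrix (Fin (r + 1)) (Fin n) ℝ := fun c l => Fin.cons (α := fun _ => ℝ)
    (initialIndicator a l + ε * residueIndicator a (r + 1) 0 l)
    (fun c : Fin r => residueIndicator a (r + 1) (c + 1) l) c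
  refine ⟨A * B, fun k l => -(ε⁻¹ * (initialIndicator a k * initialIndicator a l)), ?_, ?_, ?_⟩
  · ext k l
    change _ = (A * B) k l + -(ε⁻¹ * (initialIndicator a k * initialIndicator a l))
    rw [Matrix.mul_apply, Fin.sum_univ_succ]
    simp only [A, B, Fin.cons_zero,
      Fin.cons_succ, spikeLimit]
    field_simp
    ring
  · exact (rank_mul_le_left A B).trans (by simpa using rank_le_width A)
  · refine (sparsity_le_of_support_lt a _ fun k l h => ?_).trans ha
    by_contra hkl
    apply h
    rw [not_and_or] at hkl
    rcases hkl with hk | hk <;> simp [initialIndicator, hk]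

lemma spikeLimit_mem_closure (n a r s : ℕ) (ha : a ^ 2 ≤ s) :
    spikeLimit n a r ∈ closure (LS n n (r + 1) s) := by
  have hlim : Filter.Tendsto (fun N : ℕ => (fun k l => spikeLimit n a r k l
      + (1 / ((N : ℝ) + 1)) * (residueIndicator a (r + 1) 0 k * residueIndicator a (r + 1) 0 l) :
        Matrix (Fin n) (Fin n) ℝ)) Filter.atTop (nhds (spikeLimit n a r)) := by
    refine tendsto_pi_nhds.2 fun k => tendsto_pi_nhds.2 fun l => ?_
    simpa using tendsto_const_nhds.add
      (tendsto_one_div_add_atTop_nhds_zero_nat (𝕜 := ℝ) |>.mul_const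
        (residueIndicator a (r + 1) 0 k * residueIndicator a (r + 1) 0 l))
  refine mem_closure_of_tendsto hlim (Filter.Eventually.of_forall fun N => ?_)
  exact spikeLimit_add_mem_LS n a r s ha (by positivity)

/-- A matrix with few nonzero entries vanishes, up to one entry of the leading block, on one of
the `m * a` pairwise almost disjoint submatrices cut out by a leading index `x` together with the
row block `t` and the column block `t + x`. -/
lemma exists_vanishing_block {n : ℕ} (a m r s : ℕ) (hs : s < m * a)
    (S : Matrix (Fin n) (Fin n) ℝ) (hS : sparsity S ≤ s) :
    ∃ t < m, ∃ x < a, ∀ k l : Fin n,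
      ((k : ℕ) = x ∨ (a ≤ (k : ℕ) ∧ ((k : ℕ) - a) / r = t)) →
      ((l : ℕ) = x ∨ (a ≤ (l : ℕ) ∧ ((l : ℕ) - a) / r = t + x)) →
      ¬ ((k : ℕ) = x ∧ (l : ℕ) = x) → S k l = 0 := by
  by_contra! H
  choose k l hk hl hkl hne using fun p : Fin m × Fin a => H p.1 p.1.2 p.2 p.2.2
  let f : Fin m × Fin a → {p : Fin n × Fin n // S p.1 p.2 ≠ 0} := fun p => ⟨(k p, l p), hne p⟩
  have hf : Function.Injective f := by
    intro p p' e
    simp only [f, Subtype.mk.injEq, Prod.mk.injEq] at e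
    have h1 := hk p
    have h2 := hl p
    have h3 := hkl p
    have h1' := hk p'
    have h2' := hl p'
    have h3' := hkl p'
    rw [← e.1] at h1' h3'
    rw [← e.2] at h2' h3'
    have hx := p.2.2
    have hx' := p'.2.2
    refine Prod.ext (Fin.ext ?_) (Fin.ext ?_) <;> omega
  have := Nat.card_le_card_of_injective f hf
  simp only [Nat.card_eq_fintype_card, Fintype.card_prod, Fintype.card_fin] at this
  rw [sparsity, Nat.card_eq_fintype_card] at hS
  omega

lemma spikeLimit_notMem_LS (n a m r s : ℕ) (hs : s < m * a) (hn : a + (m + a) * (r + 1) ≤ n) :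
    spikeLimit n a r ∉ LS n n (r + 1) s := by
  rintro ⟨L, S, hM, hL, hS⟩
  obtain ⟨t, ht, x, hx, hv⟩ := exists_vanishing_block a m (r + 1) s hs S hS
  have bound : ∀ u : ℕ, u < m + a → ∀ c : Fin (r + 1), a + ((r + 1) * u + c) < n := by
    intro u hu c
    have hc := c.2
    nlinarith
  let idx : (u : ℕ) → u < m + a → Fin (r + 1 + 1) → Fin n := fun u hu =>
    Fin.cons ⟨x, by nlinarith⟩ (fun c => ⟨a + ((r + 1) * u + c), bound u hu c⟩)
  let ρ := idx t (by omega)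
  let γ := idx (t + x) (by omega)
  have hdiv : ∀ (u : ℕ) (c : Fin (r + 1)), ((r + 1) * u + c) / (r + 1) = u := fun u c => by
    rw [Nat.mul_add_div (Nat.succ_pos r), Nat.div_eq_of_lt c.2, add_zero]
  have hmod : ∀ (u : ℕ) (c : Fin (r + 1)), ((r + 1) * u + c) % (r + 1) = c := fun u c => by
    rw [Nat.mul_add_mod, Nat.mod_eq_of_lt c.2]
  have hLM : ∀ k l, L k l = spikeLimit n a r k l - S k l := fun k l => by simp [hM]
  have h0s : ∀ c : Fin (r + 1), L (ρ 0) (γ c.succ) = if c = 0 then 1 else 0 := by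
    intro c
    rw [hLM, hv _ _ (by simp [ρ, idx]) (by simp [γ, idx, hdiv])
      (by simp [ρ, γ, idx]; omega)]
    simp [spikeLimit, ρ, γ, idx, initialIndicator, residueIndicator, hmod, hx, Nat.not_le.2 hx]
  have hs0 : ∀ c : Fin (r + 1), L (ρ c.succ) (γ 0) = if c = 0 then 1 else 0 := by
    intro c
    rw [hLM, hv _ _ (by simp [ρ, idx, hdiv]) (by simp [γ, idx])
      (by simp [ρ, γ, idx]; omega)]
    simp [spikeLimit, ρ, γ, idx, initialIndicator, residueIndicator, hmod, hx, Nat.not_le.2 hx]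
  have hss : ∀ c d : Fin (r + 1),
      L (ρ c.succ) (γ d.succ) = if c = d ∧ c ≠ 0 then 1 else 0 := by
    intro c d
    rw [hLM, hv _ _ (by simp [ρ, idx, hdiv]) (by simp [γ, idx, hdiv])
      (by simp [ρ, γ, idx]; omega)]
    simp [spikeLimit, ρ, γ, idx, initialIndicator, residueIndicator, hmod]
    induction c using Fin.cases <;> induction d using Fin.cases <;>
      simp [Fin.val_inj, eq_comm, Finset.sum_ite_eq]
  have hdet : (L.submatrix ρ γ).det ≠ 0 := by
    intro h0
    obtain ⟨v, hv0, hLv⟩ := Matrix.exists_mulVec_eq_zero_iff.2 h0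
    have key : ∀ i, L (ρ i) (γ 0) * v 0 + ∑ d : Fin (r + 1), L (ρ i) (γ d.succ) * v d.succ = 0 := by
      intro i
      have := congrFun hLv i
      simpa [Matrix.mulVec, dotProduct, Fin.sum_univ_succ (n := r + 1)] using this
    have hv00 : v 0 = 0 := by
      have h := key (Fin.succ 0)
      rw [hs0] at h
      simpa only [hss, ne_eq, not_true_eq_false, and_false, if_true, if_false, one_mul, zero_mul,
        Finset.sum_const_zero, add_zero] using h
    have hvs : ∀ c : Fin (r + 1), v c.succ = 0 := by
      intro c
      by_cases hc : c = 0
      · subst hc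
        simpa [h0s, hv00] using key 0
      · simpa [hs0, hss, hc] using key c.succ
    exact hv0 (funext fun i => Fin.cases hv00 hvs i)
  have h1 := rank_of_isUnit _ ((Matrix.isUnit_iff_isUnit_det _).2 (isUnit_iff_ne_zero.2 hdet))
  have h2 : (L.submatrix ρ γ).rank ≤ L.rank := rank_submatrix_le L ρ γ
  simp only [Fintype.card_fin] at h1
  omega

theorem LS_not_closed_main (n r s : ℕ) (hr : 1 ≤ r) (hs : 1 ≤ s)
    (h : (r + 1) * (s + 2) ≤ n ∨
      ∃ p : ℕ, 1 ≤ p ∧ s = p ^ 2 * r ∧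
        ((r : ℝ) + 2) ^ ((3 : ℝ) / 2) * (s : ℝ) ^ ((1 : ℝ) / 2) ≤ (n : ℝ)) :
    ¬ IsClosed (LS n n r s) := by
  obtain ⟨a, m, ha, hma, hn⟩ : ∃ a m : ℕ, a ^ 2 ≤ s ∧ s < m * a ∧ a + (m + a) * r ≤ n := by
    rcases h with h | ⟨p, hp, rfl, h⟩
    · exact ⟨1, s + 1, by omega, by omega, by nlinarith⟩
    · refine ⟨p, p * r + 1, by nlinarith [Nat.zero_le (p ^ 2)], by nlinarith, ?_⟩
      have hsq : (r + 2) ^ 3 * (p ^ 2 * r) ≤ n ^ 2 := by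
        have h2 := pow_le_pow_left₀ (by positivity) h 2
        rw [mul_pow, ← Real.rpow_natCast, ← Real.rpow_natCast, ← Real.rpow_mul (by positivity),
          ← Real.rpow_mul (by positivity)] at h2
        norm_num at h2
        exact_mod_cast h2
      have hle : p * (r + 1) ^ 2 ≤ n := by
        refine (Nat.pow_le_pow_iff_left two_ne_zero).1 (le_trans ?_ hsq)
        have h4 : (r + 1) ^ 4 ≤ (r + 2) ^ 3 * r := by nlinarith [Nat.zero_le (r ^ 3)]
        calc (p * (r + 1) ^ 2) ^ 2 = p ^ 2 * (r + 1) ^ 4 := by ring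
          _ ≤ p ^ 2 * ((r + 2) ^ 3 * r) := by gcongr
          _ = _ := by ring
      nlinarith
  obtain ⟨r, rfl⟩ := Nat.exists_eq_add_of_le' hr
  intro hc
  exact spikeLimit_notMem_LS n a m r s hma hn (hc.closure_eq ▸ spikeLimit_mem_closure n a r s ha)
end

section
/- For integers r ≥ 1 and s ≥ 1, if n ≥ (r+1)(s+2) then the set LS_n(r,s) of n×n real matrices is not closed in the Euclidean topology on ℝ^{n×n}. -/
open Matrix

/-- A hollow corner `o` bordering the pullback along `g` of the diagonal matrix with entry `ε`
at `z` and `1` elsewhere; the border is the indicator of the fibre of `g` over `z`. -/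
def borderedMatrix {ι κ : Type*} [DecidableEq ι] [DecidableEq κ] (o : ι) (g : ι → κ) (z : κ)
    (ε : ℝ) : Matrix ι ι ℝ := fun i j =>
  if i = o then (if j = o then 0 else if g j = z then 1 else 0)
  else if j = o then (if g i = z then 1 else 0)
  else if g i = g j then (if g i = z then ε else 1) else 0

/-- For `ε ≠ 0`, a bordered matrix has rank at most `card κ` up to a change of its corner. -/
theorem borderedMatrix_eq_mul_add_single {ι κ : Type*} [DecidableEq ι] [Fintype κ]
    [DecidableEq κ] (o : ι) (g : ι → κ) (z : κ) {ε : ℝ} (hε : ε ≠ 0) :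
    borderedMatrix o g z ε =
      (Matrix.of fun i k => if i = o then (if k = z then ε⁻¹ else 0)
        else if k = g i then 1 else 0 : Matrix ι κ ℝ) *
      (Matrix.of fun k j => if j = o then (if k = z then 1 else 0)
        else if k = g j then (if k = z then ε else 1) else 0 : Matrix κ ι ℝ) +
      Matrix.single o o (-ε⁻¹) := by
  ext i j
  by_cases hi : i = o <;> by_cases hj : j = o
  · simp [borderedMatrix, Matrix.mul_apply, hi, hj]
  · simp [borderedMatrix, Matrix.mul_apply, hi, hj, Ne.symm hj]
    by_cases hz : z = g j <;> simp [hz, hε, eq_comm]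
  · simp [borderedMatrix, Matrix.mul_apply, hi, hj, Ne.symm hi, eq_comm]
  · simp only [borderedMatrix, Matrix.mul_apply, Matrix.of_apply, Matrix.add_apply, hi, hj,
      if_false, Matrix.single_apply_of_row_ne (Ne.symm hi), ite_mul, one_mul, zero_mul,
      Finset.sum_ite_eq', Finset.mem_univ, if_true, add_zero]

theorem sparsity_single_le {I J : Type*} [Fintype I] [Fintype J] [DecidableEq I] [DecidableEq J]
    (i : I) (j : J) (c : ℝ) : sparsity (Matrix.single i j c) ≤ 1 := by
  have : Subsingleton {p : I × J // Matrix.single i j c p.1 p.2 ≠ 0} := by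
    have key : ∀ p : I × J, Matrix.single i j c p.1 p.2 ≠ 0 → p = (i, j) := by
      rintro ⟨a, b⟩ hp
      by_contra hne
      refine hp (Matrix.single_apply_of_ne _ _ _ _ _ ?_)
      rintro ⟨rfl, rfl⟩
      exact hne rfl
    exact ⟨fun p q => Subtype.ext ((key _ p.2).trans (key _ q.2).symm)⟩
  exact Finite.card_le_one_iff_subsingleton.2 this

theorem borderedMatrix_mem_LS {n r s : ℕ} (hs : 1 ≤ s) (o : Fin n) (g : Fin n → Fin r)
    (z : Fin r) {ε : ℝ} (hε : ε ≠ 0) : borderedMatrix o g z ε ∈ LS n n r s := by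
  refine ⟨_, _, borderedMatrix_eq_mul_add_single o g z hε, ?_,
    (sparsity_single_le _ _ _).trans hs⟩
  exact (Matrix.rank_mul_le_left _ _).trans (Matrix.rank_le_width _)

theorem continuous_borderedMatrix {ι κ : Type*} [DecidableEq ι] [DecidableEq κ] (o : ι)
    (g : ι → κ) (z : κ) : Continuous (borderedMatrix o g z) := by
  refine continuous_matrix fun i j => ?_
  unfold borderedMatrix
  split_ifs <;> fun_prop

/-- With `ε = 0` and one representative of each class, a bordered matrix is nonsingular whatever
its corner entry. -/
theorem isUnit_of_eq_borderedMatrix_off_corner {κ : Type*} [Fintype κ] [DecidableEq κ] (z : κ)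
    (N : Matrix (Option κ) (Option κ) ℝ)
    (hN : ∀ a b, ¬(a = none ∧ b = none) →
      N a b = borderedMatrix none (fun x => x.getD z) z 0 a b) : IsUnit N := by
  rw [← Matrix.mulVec_injective_iff_isUnit]
  refine (injective_iff_map_eq_zero N.mulVecLin).2 fun x hx => ?_
  have hrow : ∀ a, N a none * x none + ∑ b, N a (some b) * x (some b) = 0 := fun a => by
    simpa [Matrix.mulVec, dotProduct, Fintype.sum_option] using congrFun hx a
  have hsome : ∀ a, (if a = z then x none else x (some a)) = 0 := fun a => by
    have := hrow (some a)
    simp only [hN _ _ (by simp : ¬(some a = none ∧ _))] at this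
    by_cases ha : a = z <;> simpa [borderedMatrix, ha] using this
  have h0 : x none = 0 := by simpa using hsome z
  have hz : x (some z) = 0 := by
    have := hrow none
    simp only [hN none (some _) (by simp)] at this
    simpa [borderedMatrix, h0] using this
  ext a
  rcases a with _ | a
  · exact h0
  · by_cases ha : a = z
    · rw [ha]; exact hz
    · simpa [ha] using hsome a

/-- If every class has `s + 1` representatives, then `s` changes do not bring the rank of the
limit matrix down to `r`. -/
theorem borderedMatrix_zero_notMem_LS {n r s : ℕ} (o : Fin n) (g : Fin n → Fin r) (z : Fin r)
    (e : Fin (s + 1) → Fin r → Fin n) (heo : ∀ k a, e k a ≠ o) (hg : ∀ k a, g (e k a) = a)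
    (he : ∀ k l a b, e k a = e l b → k = l) : borderedMatrix o g z 0 ∉ LS n n r s := by
  rintro ⟨L, S, hM, hL, hS⟩
  let f : Fin (s + 1) → Option (Fin r) → Fin n := fun k a => a.elim o (e k)
  have hf : ∀ k l a b, f k a = f l b → a ≠ none → k = l := by
    rintro k l (_ | a) (_ | b) hab ha
    · exact absurd rfl ha
    · exact absurd rfl ha
    · exact absurd hab (heo k a)
    · exact he k l a b hab
  have hex : ∀ k, ∃ a b, ¬(a = none ∧ b = none) ∧ S (f k a) (f k b) ≠ 0 := by
    intro k
    by_contra! hzero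
    have hunit : IsUnit (L.submatrix (f k) (f k)) := by
      refine isUnit_of_eq_borderedMatrix_off_corner z _ fun a b hab => ?_
      have h1 := congrFun (congrFun hM (f k a)) (f k b)
      rw [Matrix.add_apply, hzero a b (not_and.1 hab), add_zero] at h1
      rw [Matrix.submatrix_apply, ← h1]
      rcases a with _ | a <;> rcases b with _ | b <;> simp [f, borderedMatrix, heo, hg]
    have h1 := Matrix.rank_of_isUnit _ hunit
    have h2 := Matrix.rank_submatrix_le L (f k) (f k)
    simp only [Fintype.card_option, Fintype.card_fin] at h1
    omega
  choose a b hab hne using hex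
  have hinj : Function.Injective
      (fun k => (⟨(f k (a k), f k (b k)), hne k⟩ : {p : Fin n × Fin n // S p.1 p.2 ≠ 0})) := by
    intro k l hkl
    obtain ⟨h1, h2⟩ := Prod.ext_iff.1 (Subtype.ext_iff.1 hkl)
    by_cases ha : a k = none
    · exact hf _ _ _ _ h2 fun hb => hab k ⟨ha, hb⟩
    · exact hf _ _ _ _ h1 ha
  have hcard := Nat.card_le_card_of_injective _ hinj
  rw [Nat.card_fin] at hcard
  exact absurd (hcard.trans hS) (by omega)

/-- For `r ≥ 1`, `s ≥ 1`, if `n ≥ (r+1)(s+2)` then `LS_n(r,s)` is not closed. -/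
theorem LS_not_closed_of_linear_bound (n r s : ℕ) (hr : 1 ≤ r) (hs : 1 ≤ s)
    (h : (r + 1) * (s + 2) ≤ n) :
    ¬ IsClosed (LS n n r s) := by
  have hn : r * (s + 1) < n := by nlinarith
  let o : Fin n := ⟨0, by omega⟩
  let z : Fin r := ⟨0, hr⟩
  let g : Fin n → Fin r := fun i => ⟨(i - 1) % r, Nat.mod_lt _ hr⟩
  let e : Fin (s + 1) → Fin r → Fin n := fun k a => ⟨a + r * k + 1, by
    have : r * (k + 1) ≤ r * (s + 1) := Nat.mul_le_mul_left r k.2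
    rw [mul_add_one] at this
    omega⟩
  have hlim : borderedMatrix o g z 0 ∉ LS n n r s := by
    refine borderedMatrix_zero_notMem_LS o g z e (fun k a => ?_) (fun k a => ?_)
      fun k l a b hkl => ?_
    · simp [e, o]
    · ext
      simp [e, g, Nat.mod_eq_of_lt a.2]
    · have h1 : (a : ℕ) + r * k = b + r * l := by simpa [e] using hkl
      have h2 := congrArg (· / r) h1
      ext
      simpa [Nat.add_mul_div_left _ _ hr, Nat.div_eq_of_lt a.2, Nat.div_eq_of_lt b.2] using h2
  intro hclosed
  refine hlim (hclosed.mem_of_tendsto (b := nhdsWithin (0 : ℝ) {0}ᶜ)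
    ((continuous_borderedMatrix o g z).tendsto 0 |>.mono_left nhdsWithin_le_nhds) ?_)
  filter_upwards [self_mem_nhdsWithin] with ε hε
  exact borderedMatrix_mem_LS hs o g z hε
end

section
/- For integers r ≥ 1 and p ≥ 1, set s = p²·r. If n ≥ (r+2)^{3/2}·s^{1/2}, then the set LS_n(r,s) of n×n real matrices is not closed in the Euclidean topology on ℝ^{n×n}. -/
open Matrix

/-- The block-diagonal matrix with all-ones blocks given by row labels `f` and column labels `g`,
with the entry `ε` in the block of rows labelled `0` and columns labelled `r`. -/
noncomputable def blockOnes {I J : Type*} (r : ℕ) (f : I → ℕ) (g : J → ℕ) (ε : ℝ) :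
    Matrix I J ℝ :=
  fun i j => if f i = g j then 1 else if f i = 0 ∧ g j = r then ε else 0

theorem sparsity_le_of_support_subset {I J : Type*} [Fintype I] [Fintype J] (S : Matrix I J ℝ)
    (A : Finset I) (B : Finset J) (h : ∀ i j, S i j ≠ 0 → i ∈ A ∧ j ∈ B) :
    sparsity S ≤ A.card * B.card := by
  have hinj : Function.Injective (fun z : {z : I × J // S z.1 z.2 ≠ 0} =>
      (⟨z.1, Finset.mem_product.2 (h _ _ z.2)⟩ : {z // z ∈ A ×ˢ B})) := by
    intro z z' hz
    exact Subtype.ext (congrArg (fun t => t.1) hz)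
  have := Nat.card_le_card_of_injective _ hinj
  rwa [Nat.card_eq_fintype_card (α := {z // z ∈ A ×ˢ B}), Fintype.card_coe,
    Finset.card_product] at this

/-- Writing `(1/ε)(u + ε a)(v + ε b)ᵀ` for the blocks labelled `0` and `r` merges them into a
single rank-one term, up to a large correction supported on one block. -/
theorem blockOnes_mem_LS {m n r s : ℕ} (hr : 1 ≤ r) (f : Fin m → ℕ) (g : Fin n → ℕ)
    (hf : ∀ i, f i ≤ r) (hsupp : (Finset.univ.filter fun i => f i = r).card *
      (Finset.univ.filter fun j => g j = 0).card ≤ s) {ε : ℝ} (hε : ε ≠ 0) :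
    blockOnes r f g ε ∈ LS m n r s := by
  let U : Matrix (Fin m) (Fin r) ℝ := fun i k =>
    if (if f i = r then 0 else f i) = (k : ℕ) then (if f i = r then ε⁻¹ else 1) else 0
  let V : Matrix (Fin r) (Fin n) ℝ := fun k j =>
    if (if g j = r then 0 else g j) = (k : ℕ) then (if g j = r then ε else 1) else 0
  let S : Matrix (Fin m) (Fin n) ℝ := fun i j => if f i = r ∧ g j = 0 then -ε⁻¹ else 0
  refine ⟨U * V, S, ?_, ?_, ?_⟩
  · ext i j
    have hlt : (if f i = r then 0 else f i) < r := by
      have := hf i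
      split_ifs <;> omega
    have hUV : (U * V) i j = (if f i = r then ε⁻¹ else 1) * V ⟨_, hlt⟩ j := by
      rw [Matrix.mul_apply, Finset.sum_eq_single ⟨_, hlt⟩]
      · simp [U]
      · intro k _ hk
        have : ¬ (if f i = r then 0 else f i) = (k : ℕ) := fun h => hk (Fin.ext h.symm)
        simp only [U, if_neg this, zero_mul]
      · simp
    rw [Matrix.add_apply, hUV]
    simp only [V, S, blockOnes]
    have hinv := inv_mul_cancel₀ hε
    split_ifs <;> grind
  · exact (Matrix.rank_mul_le_left U V).trans (by simpa using Matrix.rank_le_width U)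
  · refine (sparsity_le_of_support_subset S _ _ fun i j hij => ?_).trans hsupp
    simp only [S] at hij
    simpa using fun h => hij (if_neg h)

theorem blockOnes_zero_mem_of_isClosed {m n r s : ℕ} (hr : 1 ≤ r) (f : Fin m → ℕ)
    (g : Fin n → ℕ) (hf : ∀ i, f i ≤ r)
    (hsupp : (Finset.univ.filter fun i => f i = r).card *
      (Finset.univ.filter fun j => g j = 0).card ≤ s) (hcl : IsClosed (LS m n r s)) :
    blockOnes r f g 0 ∈ LS m n r s := by
  have hcont : Continuous (blockOnes r f g) := by
    refine continuous_pi fun i => continuous_pi fun j => ?_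
    unfold blockOnes
    split_ifs <;> fun_prop
  have ht : Filter.Tendsto (blockOnes r f g) (nhdsWithin 0 {0}ᶜ) (nhds (blockOnes r f g 0)) :=
    hcont.continuousAt.mono_left nhdsWithin_le_nhds
  refine hcl.mem_of_tendsto ht ?_
  filter_upwards [self_mem_nhdsWithin] with ε hε
  exact blockOnes_mem_LS hr f g hf hsupp hε

/-- Reducing the rank of a block-diagonal matrix of ones below its number of blocks requires
changing an entry in every transversal submatrix, outside the corner `(r, 0)`. -/
theorem exists_ne_zero_of_rank_le {I J : Type*} [Fintype I] [Fintype J] {r : ℕ} (hr : 1 ≤ r)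
    (f : I → ℕ) (g : J → ℕ) (L S : Matrix I J ℝ) (hM : blockOnes r f g 0 = L + S)
    (hL : L.rank ≤ r) (x : Fin (r + 1) → I) (y : Fin (r + 1) → J)
    (hx : ∀ k, f (x k) = k) (hy : ∀ k, g (y k) = k) :
    ∃ k l : Fin (r + 1), ¬ ((k : ℕ) = r ∧ (l : ℕ) = 0) ∧ S (x k) (y l) ≠ 0 := by
  by_contra! hS
  have hent : ∀ k l : Fin (r + 1), ¬ ((k : ℕ) = r ∧ (l : ℕ) = 0) →
      L (x k) (y l) = if k = l then 1 else 0 := by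
    intro k l hkl
    have h1 := congrFun (congrFun hM (x k)) (y l)
    rw [Matrix.add_apply, hS k l (not_and.1 hkl), add_zero] at h1
    rw [← h1]
    simp only [blockOnes, hx, hy, Fin.ext_iff, ite_self]
  have hdet : (L.submatrix x y).det = 1 := by
    rw [Matrix.det_of_isLowerTriangular]
    · refine Finset.prod_eq_one fun k _ => ?_
      rw [Matrix.submatrix_apply, hent k k (by omega), if_pos rfl]
    · intro k l hkl
      have hkl' : k < l := hkl
      rw [Matrix.submatrix_apply, hent k l (by omega), if_neg hkl'.ne]
  have hrank := Matrix.rank_of_isUnit (L.submatrix x y)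
    ((Matrix.isUnit_iff_isUnit_det _).2 (by simp [hdet]))
  have := Matrix.rank_submatrix_le L x y
  simp at hrank
  omega

/-- Label of a row: the first `p` rows have label `r`, and the others are cut into blocks of
length `w` labelled `0, …, r - 1`, the last of which takes the remainder. -/
def rowLabel (r p w i : ℕ) : ℕ := if i < p then r else min (r - 1) ((i - p) / w)

/-- Label of a column: the first `p` columns have label `0`, and the others are cut into blocks of
length `w` labelled `1, …, r`, the last of which takes the remainder. -/
def colLabel (r p w j : ℕ) : ℕ := if j < p then 0 else min r (1 + (j - p) / w)

/-- The row with label `k` in the transversal submatrix of index `(a, c)`. -/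
def rowPick (r p w k a c : ℕ) : ℕ := if k = r then a else p + (k * w + (a + c))

/-- The column with label `l` in the transversal submatrix of index `(a, c)`. -/
def colPick (p w l a c : ℕ) : ℕ := if l = 0 then a else p + ((l - 1) * w + c)

theorem rowLabel_rowPick {r p w k a c : ℕ} (hk : k ≤ r) (ha : a < p) (hac : a + c < w) :
    rowLabel r p w (rowPick r p w k a c) = k := by
  unfold rowLabel rowPick
  by_cases h : k = r
  · simp [h, ha]
  · have : (k * w + (a + c)) / w = k := by
      rw [mul_comm, Nat.mul_add_div (by omega), Nat.div_eq_of_lt hac, add_zero]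
    rw [if_neg h, if_neg (by omega), Nat.add_sub_cancel_left, this]
    omega

theorem colLabel_colPick {r p w l a c : ℕ} (hl : l ≤ r) (ha : a < p) (hc : c < w) :
    colLabel r p w (colPick p w l a c) = l := by
  unfold colLabel colPick
  by_cases h : l = 0
  · simp [h, ha]
  · have : ((l - 1) * w + c) / w = l - 1 := by
      rw [mul_comm, Nat.mul_add_div (by omega), Nat.div_eq_of_lt hc, add_zero]
    rw [if_neg h, if_neg (by omega), Nat.add_sub_cancel_left, this]
    omega

theorem rowPick_lt {r p w k a c n : ℕ} (hk : k ≤ r) (ha : a < p) (hac : a + c < w)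
    (hn : p + r * w ≤ n) : rowPick r p w k a c < n := by
  unfold rowPick
  split_ifs with h
  · omega
  · have : (k + 1) * w ≤ r * w := Nat.mul_le_mul_right _ (by omega)
    rw [add_mul] at this
    omega

theorem colPick_lt {r p w l a c n : ℕ} (hl : l ≤ r) (ha : a < p) (hc : c < w)
    (hn : p + r * w ≤ n) : colPick p w l a c < n := by
  unfold colPick
  split_ifs with h
  · omega
  · have : (l - 1 + 1) * w ≤ r * w := Nat.mul_le_mul_right _ (by omega)
    rw [add_mul] at this
    omega

theorem pick_injective {r p w k l a c a' c' : ℕ} (hkl : ¬ (k = r ∧ l = 0))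
    (hrow : rowPick r p w k a c = rowPick r p w k a' c')
    (hcol : colPick p w l a c = colPick p w l a' c') : a = a' ∧ c = c' := by
  unfold rowPick at hrow
  unfold colPick at hcol
  split_ifs at hrow hcol <;> omega

theorem card_filter_val_lt_le {n p : ℕ} (P : Fin n → Prop) [DecidablePred P]
    (h : ∀ i, P i → (i : ℕ) < p) : (Finset.univ.filter P).card ≤ p := by
  have := Finset.card_le_card_of_injOn (s := Finset.univ.filter P) (t := Finset.range p)
    (fun i => (i : ℕ)) (fun i hi => by simpa using h i (by simpa using hi))
    (Fin.val_injective.injOn)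
  simpa using this

theorem LS_not_isClosed_of_mul_le {n r p s q : ℕ} (hr : 1 ≤ r) (hps : p * p ≤ s)
    (hsq : s < p * q) (hn : p + r * (p + q) ≤ n) : ¬ IsClosed (LS n n r s) := by
  intro hcl
  set w := p + q with hw
  let f : Fin n → ℕ := fun i => rowLabel r p w i
  let g : Fin n → ℕ := fun j => colLabel r p w j
  have hf : ∀ i, f i ≤ r := by
    intro i
    simp only [f, rowLabel]
    split_ifs <;> omega
  have hsupp : (Finset.univ.filter fun i => f i = r).card *
      (Finset.univ.filter fun j => g j = 0).card ≤ s := by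
    refine le_trans (Nat.mul_le_mul ?_ ?_) hps
    · refine card_filter_val_lt_le _ fun i hi => ?_
      simp only [f, rowLabel] at hi
      split_ifs at hi <;> omega
    · refine card_filter_val_lt_le _ fun j hj => ?_
      simp only [g, colLabel] at hj
      split_ifs at hj with hjp
      · exact hjp
      · generalize (j.val - p) / w = t at hj
        omega
  obtain ⟨L, S, hM, hL, hS⟩ := blockOnes_zero_mem_of_isClosed hr f g hf hsupp hcl
  let x : Fin p × Fin q → Fin (r + 1) → Fin n := fun t k =>
    ⟨rowPick r p w k t.1 t.2, rowPick_lt (by omega) t.1.2 (by omega) hn⟩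
  let y : Fin p × Fin q → Fin (r + 1) → Fin n := fun t l =>
    ⟨colPick p w l t.1 t.2, colPick_lt (by omega) t.1.2 (by omega) hn⟩
  have hx : ∀ t k, f (x t k) = k := fun t k =>
    rowLabel_rowPick (by omega) t.1.2 (by omega)
  have hy : ∀ t l, g (y t l) = l := fun t l =>
    colLabel_colPick (by omega) t.1.2 (by omega)
  choose k l hkl hne using fun t =>
    exists_ne_zero_of_rank_le hr f g L S hM hL (x t) (y t) (hx t) (hy t)
  let φ : Fin p × Fin q → {z : Fin n × Fin n // S z.1 z.2 ≠ 0} := fun t =>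
    ⟨(x t (k t), y t (l t)), hne t⟩
  have hφ : Function.Injective φ := by
    intro t t' h
    have h1 : x t (k t) = x t' (k t') := congrArg (fun z => z.1.1) h
    have h2 : y t (l t) = y t' (l t') := congrArg (fun z => z.1.2) h
    have hk : k t = k t' := Fin.ext (by rw [← hx t (k t), ← hx t' (k t'), h1])
    have hl : l t = l t' := Fin.ext (by rw [← hy t (l t), ← hy t' (l t'), h2])
    rw [← hk] at h1
    rw [← hl] at h2
    obtain ⟨ha, hc⟩ := pick_injective (hkl t) (congrArg Fin.val h1) (congrArg Fin.val h2)
    exact Prod.ext (Fin.ext ha) (Fin.ext hc)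
  have hcard := Nat.card_le_card_of_injective φ hφ
  rw [Nat.card_prod, Nat.card_fin, Nat.card_fin] at hcard
  exact absurd (hcard.trans hS) (by omega)

/-- For `r ≥ 1`, `p ≥ 1` and `s = p² r`, if `n ≥ (r+2)^{3/2} s^{1/2}`
then `LS_n(r,s)` is not closed. -/
theorem LS_not_closed_of_quadratic_sparsity (n r p s : ℕ) (hr : 1 ≤ r) (hp : 1 ≤ p)
    (hs : s = p ^ 2 * r)
    (h : ((r : ℝ) + 2) ^ ((3 : ℝ) / 2) * (s : ℝ) ^ ((1 : ℝ) / 2) ≤ (n : ℝ)) :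
    ¬ IsClosed (LS n n r s) := by
  have hr2 : (0 : ℝ) ≤ (r : ℝ) + 2 := by positivity
  have hsq : (((r : ℝ) + 2) ^ ((3 : ℝ) / 2) * (s : ℝ) ^ ((1 : ℝ) / 2)) ^ 2
      = ((r : ℝ) + 2) ^ 3 * s := by
    rw [mul_pow, ← Real.rpow_mul_natCast hr2, ← Real.rpow_mul_natCast s.cast_nonneg]
    rw [show (3 : ℝ) / 2 * (2 : ℕ) = (3 : ℕ) by norm_num,
      show (1 : ℝ) / 2 * (2 : ℕ) = 1 by norm_num, Real.rpow_natCast, Real.rpow_one]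
  have hn2 : (r + 2) ^ 3 * s ≤ n ^ 2 := by
    have := pow_le_pow_left₀ (by positivity) h 2
    rw [hsq] at this
    exact_mod_cast this
  have hn : p * (r + 1) ^ 2 ≤ n := by
    refine (pow_le_pow_iff_left₀ (Nat.zero_le _) n.zero_le two_ne_zero).1 ?_
    refine le_trans ?_ hn2
    have : (r + 1) ^ 4 ≤ (r + 2) ^ 3 * r := by nlinarith [Nat.zero_le (r ^ 3), Nat.zero_le (r ^ 2)]
    calc (p * (r + 1) ^ 2) ^ 2 = p ^ 2 * (r + 1) ^ 4 := by ring
      _ ≤ p ^ 2 * ((r + 2) ^ 3 * r) := Nat.mul_le_mul_left _ this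
      _ = (r + 2) ^ 3 * s := by rw [hs]; ring
  refine LS_not_isClosed_of_mul_le (p := p) (q := p * (r + 1)) hr ?_ ?_ ?_
  · rw [hs]
    nlinarith
  · rw [hs]
    nlinarith
  · refine le_trans (le_of_eq ?_) hn
    ring
end

section
/- Let n > r ≥ 1 and let A, Bᵀ ∈ ℝ^{r×(n−r)} be arbitrary. For ε ≠ 0 define M(ε) ∈ ℝ^{n×n} to be the block matrix with blocks [[0_{r,r}, A], [B, ε·B·A]], and define M ∈ ℝ^{n×n} to be the block matrix [[0_{r,r}, A], [B, 0_{n−r,n−r}]]. Then M(ε) ∈ LS_n(r,r) for every ε ≠ 0, and ‖M(ε) − M‖_F → 0 as ε → 0. -/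
open Matrix

theorem Matrix.rank_fromBlocks_smul_one_le {m k : Type*} [Fintype m] [Fintype k] [DecidableEq m]
    (A : Matrix m k ℝ) (B : Matrix k m ℝ) {ε : ℝ} (hε : ε ≠ 0) :
    (Matrix.fromBlocks (ε⁻¹ • 1) A B (ε • (B * A))).rank ≤ Fintype.card m := by
  have h : Matrix.fromBlocks (ε⁻¹ • 1) A B (ε • (B * A)) =
      Matrix.fromRows 1 (ε • B) * Matrix.fromCols (ε⁻¹ • 1) A := by
    rw [Matrix.fromRows_mul_fromCols]
    simp [smul_smul, hε]
  rw [h]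
  exact (Matrix.rank_mul_le_left _ _).trans (Matrix.rank_le_card_width _)

theorem sparsity_le_card_of_ne_zero_imp {I J K : Type*} [Fintype I] [Fintype J] [Fintype K]
    (S : Matrix I J ℝ) (f : K → I × J) (h : ∀ i j, S i j ≠ 0 → ∃ k, f k = (i, j)) :
    sparsity S ≤ Fintype.card K := by
  have hsub : {p : I × J | S p.1 p.2 ≠ 0} ⊆ Set.range f := fun p hp => h p.1 p.2 hp
  calc sparsity S ≤ Nat.card (Set.range f) := Nat.card_mono (Set.toFinite _) hsub
    _ ≤ Nat.card K := Finite.card_range_le f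
    _ = Fintype.card K := Nat.card_eq_fintype_card

theorem tendsto_frobNorm_smul_zero {I J : Type*} [Fintype I] [Fintype J] (N : Matrix I J ℝ) :
    Filter.Tendsto (fun ε : ℝ => frobNorm (ε • N)) (nhds 0) (nhds 0) := by
  have hc : Continuous fun ε : ℝ => frobNorm (ε • N) := by
    simp only [frobNorm, Matrix.smul_apply, smul_eq_mul]
    fun_prop
  simpa [frobNorm] using hc.tendsto 0

/-- General form of `M⁽¹⁾`: with `M(ε)` the block matrix `[[0, A], [B, ε·B·A]]`
and `M` the block matrix `[[0, A], [B, 0]]`, written as `n × n` matrices,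
`M(ε) ∈ LS_n(r,r)` for every `ε ≠ 0`, and `‖M(ε) − M‖_F → 0` as `ε → 0`. -/
theorem block_construction_mem_LS_and_tendsto (n r : ℕ) (hr : 1 ≤ r) (hn : r < n)
    (A : Matrix (Fin r) (Fin (n - r)) ℝ) (B : Matrix (Fin (n - r)) (Fin r) ℝ) :
    let e : Fin r ⊕ Fin (n - r) ≃ Fin n :=
      finSumFinEquiv.trans (finCongr (Nat.add_sub_cancel' hn.le))
    let Mε : ℝ → Matrix (Fin n) (Fin n) ℝ := fun ε =>
      Matrix.reindex e e (Matrix.fromBlocks 0 A B (ε • (B * A)))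
    let M : Matrix (Fin n) (Fin n) ℝ :=
      Matrix.reindex e e (Matrix.fromBlocks 0 A B 0)
    (∀ ε : ℝ, ε ≠ 0 → Mε ε ∈ LS n n r r) ∧
      Filter.Tendsto (fun ε : ℝ => frobNorm (Mε ε - M))
        (nhdsWithin 0 {(0 : ℝ)}ᶜ) (nhds 0) := by
  intro e Mε M
  refine ⟨fun ε hε => ⟨Matrix.reindex e e (Matrix.fromBlocks (ε⁻¹ • 1) A B (ε • (B * A))),
    Matrix.reindex e e (Matrix.fromBlocks (-(ε⁻¹ • 1)) 0 0 0), ?_, ?_, ?_⟩, ?_⟩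
  · ext i j
    simp only [Mε, Matrix.add_apply, Matrix.reindex_apply, Matrix.submatrix_apply]
    rcases e.symm i with i | i <;> rcases e.symm j with j | j <;> simp
  · rw [Matrix.rank_reindex]
    simpa using Matrix.rank_fromBlocks_smul_one_le A B hε
  · refine (sparsity_le_card_of_ne_zero_imp _ (fun k : Fin r => (e (.inl k), e (.inl k))) ?_).trans
      (Fintype.card_fin r).le
    intro i j hij
    obtain ⟨i, rfl⟩ := e.surjective i
    obtain ⟨j, rfl⟩ := e.surjective j
    rw [Matrix.reindex_apply, Matrix.submatrix_apply, e.symm_apply_apply, e.symm_apply_apply] at hij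
    rcases i with i | i <;> rcases j with j | j <;> simp [Matrix.one_apply] at hij
    exact ⟨i, by rw [hij.1]⟩
  · have h : ∀ ε, Mε ε - M = ε • Matrix.reindex e e (Matrix.fromBlocks 0 0 0 (B * A)) := by
      intro ε
      ext i j
      simp only [Mε, M, Matrix.sub_apply, Matrix.smul_apply, Matrix.reindex_apply,
        Matrix.submatrix_apply]
      rcases e.symm i with i | i <;> rcases e.symm j with j | j <;> simp
    simp only [h]
    exact (tendsto_frobNorm_smul_zero _).mono_left nhdsWithin_le_nhds
end

section
/- Let 1 ≤ r ≤ s be integers and set l = ⌈(s+1)/2⌉ and k = ⌈l/r⌉. If n ≥ r(l+1) + k, then the set LS_n(r,s) of n×n real matrices is not closed in the Euclidean topology on ℝ^{n×n}. -/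
open Matrix

/-- The pattern `[[0, A], [Aᵀ, 0]]` whose top-left block is `r × r` and where
`A = [1 1 ⋯ 1]` is a row of `r × r` identity blocks. -/
def borderMatrix (n r : ℕ) : Matrix (Fin n) (Fin n) ℝ := fun i j =>
  if i.1 % r = j.1 % r ∧ ¬ (i.1 < r ↔ j.1 < r) then 1 else 0

/-- The complementary pattern `[[0, 0], [0, AᵀA]]` with `A` as in `borderMatrix`. -/
def innerMatrix (n r : ℕ) : Matrix (Fin n) (Fin n) ℝ := fun i j =>
  if i.1 % r = j.1 % r ∧ ¬ i.1 < r ∧ ¬ j.1 < r then 1 else 0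

theorem sparsity_le_card_of_injOn {I J α : Type*} [Fintype I] [Fintype J]
    (S : Matrix I J ℝ) (t : Finset α) (f : I × J → α)
    (hf : ∀ p : I × J, S p.1 p.2 ≠ 0 → f p ∈ t)
    (hinj : ∀ p p' : I × J, S p.1 p.2 ≠ 0 → S p'.1 p'.2 ≠ 0 → f p = f p' → p = p') :
    sparsity S ≤ t.card := by
  have h := Nat.card_le_card_of_injective
    (fun p : {p : I × J // S p.1 p.2 ≠ 0} => (⟨f p.1, hf p.1 p.2⟩ : t))
    (fun p p' h => Subtype.ext (hinj p.1 p'.1 p.2 p'.2 (congrArg Subtype.val h)))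
  simpa [sparsity] using h

theorem sparsity_eq_card_filter {I J : Type*} [Fintype I] [Fintype J]
    (S : Matrix I J ℝ) [DecidablePred fun p : I × J => S p.1 p.2 ≠ 0] :
    sparsity S = (Finset.univ.filter fun p : I × J => S p.1 p.2 ≠ 0).card := by
  rw [sparsity, Nat.card_eq_fintype_card, Fintype.card_subtype]

theorem Matrix.rank_add_le {I J K : Type*} [Fintype I] [Fintype J] [Field K]
    (A B : Matrix I J K) : (A + B).rank ≤ A.rank + B.rank := by
  rw [Matrix.rank, Matrix.mulVecLin_add]
  exact (Submodule.finrank_mono (LinearMap.range_add_le _ _)).trans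
    (Submodule.finrank_add_le_finrank_add_finrank _ _)

theorem rank_le_sparsity {I J : Type*} [Fintype I] [Fintype J] (S : Matrix I J ℝ) :
    S.rank ≤ sparsity S := by
  classical
  rw [sparsity_eq_card_filter]
  refine (Matrix.rank_le_card_of_support_subset S
    ((Finset.univ.filter fun p : I × J => S p.1 p.2 ≠ 0).image Prod.fst) ?_).trans
    Finset.card_image_le
  intro i hi
  obtain ⟨j, hj⟩ := Function.ne_iff.1 hi
  simpa using ⟨j, hj⟩

theorem rank_fromBlocks_one_one_zero {r : ℕ} (D : Matrix (Fin r) (Fin r) ℝ) :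
    (Matrix.fromBlocks D (1 : Matrix (Fin r) (Fin r) ℝ) (1 : Matrix (Fin r) (Fin r) ℝ) 0).rank =
      r + r := by
  have h : Matrix.fromBlocks D (1 : Matrix (Fin r) (Fin r) ℝ) (1 : Matrix (Fin r) (Fin r) ℝ) 0 *
      Matrix.fromBlocks 0 1 1 (-D) = 1 := by
    simp [Matrix.fromBlocks_multiply]
  rw [Matrix.rank_of_isUnit _ (IsUnit.of_mul_eq_one _ h)]
  simp

theorem add_smul_mem_LS {n r s : ℕ} (hr : 1 ≤ r) (hrs : r ≤ s) {ε : ℝ} (hε : ε ≠ 0) :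
    borderMatrix n r + ε • innerMatrix n r ∈ LS n n r s := by
  let c : ℕ → Fin r := fun i => ⟨i % r, Nat.mod_lt _ hr⟩
  let U : Matrix (Fin n) (Fin r) ℝ := fun i a =>
    if c i = a then (if i.1 < r then ε⁻¹ else 1) else 0
  let V : Matrix (Fin r) (Fin n) ℝ := fun a j =>
    if c j = a then (if j.1 < r then 1 else ε) else 0
  refine ⟨U * V, borderMatrix n r + ε • innerMatrix n r - U * V, by abel,
    (Matrix.rank_mul_le_left U V).trans (Matrix.rank_le_width U), ?_⟩
  have key : ∀ i j : Fin n, (borderMatrix n r + ε • innerMatrix n r - U * V) i j ≠ 0 →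
      i = j ∧ i.1 < r := by
    intro i j hij
    by_contra hcon
    apply hij
    have hc : c i = c j ↔ i.1 % r = j.1 % r := by simp [c]
    have hUV : (U * V) i j = if i.1 % r = j.1 % r then
        (if i.1 < r then ε⁻¹ else 1) * (if j.1 < r then 1 else ε) else 0 := by
      rw [Matrix.mul_apply, Finset.sum_eq_single (c i) (fun a _ ha => by simp [U, ha.symm])
        (by simp)]
      simp only [U, V, if_true, eq_comm (a := c j), hc, mul_ite, mul_zero]
    simp only [Matrix.sub_apply, Matrix.add_apply, Matrix.smul_apply, hUV, borderMatrix,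
      innerMatrix, smul_eq_mul]
    by_cases h : i.1 % r = j.1 % r
    · by_cases hi : i.1 < r <;> by_cases hj : j.1 < r
      · rw [Nat.mod_eq_of_lt hi, Nat.mod_eq_of_lt hj] at h
        exact absurd ⟨Fin.ext h, hi⟩ hcon
      all_goals simp [h, hi, hj, hε]
    · simp [h]
  refine le_trans (sparsity_le_card_of_injOn _ (Finset.range r) (fun p => p.1.1) ?_ ?_)
    (by simpa using hrs)
  · intro p hp
    simpa using (key _ _ hp).2
  · rintro ⟨i, j⟩ ⟨i', j'⟩ hp hp' h
    have hi : i = j := (key _ _ hp).1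
    have hi' : i' = j' := (key _ _ hp').1
    have hii : i = i' := Fin.ext h
    rw [← hi, ← hi', hii]

theorem borderMatrix_mem_closure_LS {n r s : ℕ} (hr : 1 ≤ r) (hrs : r ≤ s) :
    borderMatrix n r ∈ closure (LS n n r s) := by
  have h : Filter.Tendsto
      (fun m : ℕ => borderMatrix n r + (1 / ((m : ℝ) + 1)) • innerMatrix n r)
      Filter.atTop (nhds (borderMatrix n r)) := by
    simpa using (tendsto_one_div_add_atTop_nhds_zero_nat (𝕜 := ℝ)).smul_const
      (innerMatrix n r) |>.const_add (borderMatrix n r)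
  exact mem_closure_of_tendsto h
    (Filter.Eventually.of_forall fun m => add_smul_mem_LS hr hrs (by positivity))

theorem le_card_block_support {n r b : ℕ} (hb : 1 ≤ b) (hbn : r + r * b ≤ n)
    {L S : Matrix (Fin n) (Fin n) ℝ} (hLS : borderMatrix n r = L + S) (hL : L.rank ≤ r)
    [DecidablePred fun p : Fin n × Fin n => S p.1 p.2 ≠ 0] :
    r ≤ ((Finset.univ.filter fun p : Fin n × Fin n => S p.1 p.2 ≠ 0).filter
      fun p => max p.1.1 p.2.1 / r = b).card := by
  have hrb : r ≤ r * b := Nat.le_mul_of_pos_right r hb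
  let e : Fin r ⊕ Fin r → Fin n :=
    Sum.elim (fun a => ⟨a, by omega⟩) (fun a => ⟨a + r * b, by omega⟩)
  let T : Matrix (Fin r ⊕ Fin r) (Fin r ⊕ Fin r) ℝ := S.submatrix e e
  have hdiv : ∀ a < r, (a + r * b) / r = b := fun a ha => by
    rw [Nat.add_mul_div_left _ _ (by omega), Nat.div_eq_of_lt ha, zero_add]
  have hM : ∀ x y, borderMatrix n r (e x) (e y) = L (e x) (e y) + S (e x) (e y) :=
    fun x y => by rw [hLS]; rfl
  have hdecomp : Matrix.fromBlocks (L.submatrix e e).toBlocks₁₁ 1 1 0 =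
      L.submatrix e e + Matrix.fromBlocks 0 T.toBlocks₁₂ T.toBlocks₂₁ T.toBlocks₂₂ := by
    ext x y
    have h := hM x y
    rcases x with x | x <;> rcases y with y | y
    · simp [Matrix.toBlocks₁₁]
    all_goals
      have hx := x.2
      have hy := y.2
      have hx' : ¬ x.1 + r * b < r := by omega
      have hy' : ¬ y.1 + r * b < r := by omega
      simp [borderMatrix, e, Nat.mod_eq_of_lt, hx', hy', ← Fin.ext_iff] at h
      simp [Matrix.toBlocks₁₂, Matrix.toBlocks₂₁, Matrix.toBlocks₂₂, T, e, Matrix.one_apply, h]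
  have hrank := congrArg Matrix.rank hdecomp
  rw [rank_fromBlocks_one_one_zero] at hrank
  have hadd := Matrix.rank_add_le (L.submatrix e e)
    (Matrix.fromBlocks 0 T.toBlocks₁₂ T.toBlocks₂₁ T.toBlocks₂₂)
  have hsub : (L.submatrix e e).rank ≤ L.rank := Matrix.rank_submatrix_le L e e
  have hsp := rank_le_sparsity (Matrix.fromBlocks 0 T.toBlocks₁₂ T.toBlocks₂₁ T.toBlocks₂₂)
  have he : Function.Injective e := by
    rintro (x | x) (y | y) h <;> have := x.2 <;> have := y.2 <;>
      simp [e, Fin.ext_iff] at h ⊢ <;> omega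
  refine le_trans (by omega) (hsp.trans (sparsity_le_card_of_injOn _ _
    (fun p => (e p.1, e p.2)) ?_ ?_))
  · rintro ⟨x | x, y | y⟩ hp
    · simp at hp
    all_goals
      have hx := x.2
      have hy := y.2
      refine Finset.mem_filter.2 ⟨Finset.mem_filter.2 ⟨Finset.mem_univ _, hp⟩, ?_⟩
    · rw [max_eq_right (by simp [e]; omega)]
      exact hdiv _ hy
    · rw [max_eq_left (by simp [e]; omega)]
      exact hdiv _ hx
    · rcases max_choice (e (Sum.inr x)).1 (e (Sum.inr y)).1 with h | h <;> rw [h]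
      · exact hdiv _ hx
      · exact hdiv _ hy
  · rintro ⟨x, y⟩ ⟨x', y'⟩ - - h
    obtain ⟨h₁, h₂⟩ := Prod.ext_iff.1 h
    exact Prod.ext (he h₁) (he h₂)

theorem borderMatrix_notMem_LS {n r s q : ℕ} (hn : r + r * q ≤ n) (hs : s < r * q) :
    borderMatrix n r ∉ LS n n r s := by
  classical
  rintro ⟨L, S, hLS, hL, hS⟩
  refine absurd (hS.trans_lt hs) (not_lt.2 ?_)
  rw [sparsity_eq_card_filter]
  calc r * q = ∑ b ∈ Finset.Icc 1 q, r := by simp [mul_comm]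
    _ ≤ ∑ b ∈ Finset.Icc 1 q, ((Finset.univ.filter fun p : Fin n × Fin n =>
        S p.1 p.2 ≠ 0).filter fun p => max p.1.1 p.2.1 / r = b).card := by
      refine Finset.sum_le_sum fun b hb => ?_
      obtain ⟨hb1, hbq⟩ := Finset.mem_Icc.1 hb
      exact le_card_block_support hb1
        (le_trans (by gcongr) hn) hLS hL
    _ ≤ _ := by
      rw [Finset.sum_card_fiberwise_eq_card_filter]
      exact Finset.card_filter_le _ _

/-- For `1 ≤ r ≤ s`, with `l = ⌈(s+1)/2⌉` and `k = ⌈l/r⌉`, if `n ≥ r(l+1) + k`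
then `LS_n(r,s)` is not closed. -/
theorem LS_not_closed_r_le_s (n r s : ℕ) (hr : 1 ≤ r) (hrs : r ≤ s)
    (l k : ℕ) (hl : l = ⌈((s : ℚ) + 1) / 2⌉₊) (hk : k = ⌈(l : ℚ) / (r : ℚ)⌉₊)
    (hn : r * (l + 1) + k ≤ n) :
    ¬ IsClosed (LS n n r s) := by
  have hsl : s + 1 ≤ 2 * l := by
    have h := Nat.le_ceil (((s : ℚ) + 1) / 2)
    rw [← hl, div_le_iff₀ two_pos] at h
    have h' : s + 1 ≤ l * 2 := by exact_mod_cast h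
    omega
  obtain ⟨q, hq, hs⟩ : ∃ q, r + r * q ≤ n ∧ s < r * q := by
    obtain rfl | hr2 := hr.eq_or_lt
    · have hkl : k = l := by simpa using hk
      exact ⟨2 * l, by omega, by omega⟩
    · refine ⟨l, by linarith [mul_add r l 1], ?_⟩
      have : 2 * l ≤ r * l := by gcongr; exact hr2
      omega
  intro hclosed
  exact borderMatrix_notMem_LS hq hs
    (hclosed.closure_eq ▸ borderMatrix_mem_closure_LS hr hrs)
end

section
/- Let M̂ ∈ ℝ^{n'×n'}, let p ≥ 1 be an integer, and let K ∈ ℝ^{(pn')×(pn')} be the p×p block matrix each of whose n'×n' blocks equals M̂ (that is, K = J_p ⊗ M̂, where J_p is the p×p all-ones matrix and ⊗ is the Kronecker product). Then for every natural number r, Rig(K, r) ≥ p² · Rig(M̂, r). -/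
open Matrix

theorem sparsity_eq_sum {I J : Type*} [Fintype I] [Fintype J] (S : Matrix I J ℝ) :
    sparsity S = ∑ i, ∑ j, if S i j ≠ 0 then 1 else 0 := by
  classical
  rw [sparsity, Nat.card_eq_fintype_card, Fintype.card_subtype, Finset.card_filter,
    Fintype.sum_prod_type]

theorem sparsity_submatrix_equiv {I J I' J' : Type*} [Fintype I] [Fintype J] [Fintype I']
    [Fintype J'] (S : Matrix I J ℝ) (e : I' ≃ I) (f : J' ≃ J) :
    sparsity (S.submatrix e f) = sparsity S :=
  Nat.card_congr ((e.prodCongr f).subtypeEquiv fun _ => Iff.rfl)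

theorem sparsity_eq_sum_blocks {P Q I J : Type*} [Fintype P] [Fintype Q] [Fintype I]
    [Fintype J] (S : Matrix (P × I) (Q × J) ℝ) :
    sparsity S = ∑ a, ∑ b, sparsity (S.submatrix (Prod.mk a) (Prod.mk b)) := by
  simp only [sparsity_eq_sum, Fintype.sum_prod_type, Matrix.submatrix_apply]
  exact Finset.sum_congr rfl fun _ _ => Finset.sum_comm

theorem exists_sparsity_eq_rig {I J : Type*} [Fintype I] [Fintype J] (M : Matrix I J ℝ)
    (r : ℕ) : ∃ S : Matrix I J ℝ, (M - S).rank ≤ r ∧ sparsity S = Rig M r :=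
  Nat.sInf_mem (s := {k | ∃ S : Matrix I J ℝ, (M - S).rank ≤ r ∧ sparsity S = k})
    ⟨sparsity M, M, by simp, rfl⟩

theorem rig_le_sparsity {I J : Type*} [Fintype I] [Fintype J] {M S : Matrix I J ℝ}
    {r : ℕ} (h : (M - S).rank ≤ r) : Rig M r ≤ sparsity S :=
  Nat.sInf_le ⟨S, h, rfl⟩

open Kronecker in
/-- Rigidity of a `p × p` block matrix `K = J_p ⊗ M̂` (every block equal to `M̂`)
is at least `p²` times the rigidity of `M̂`. -/
theorem rigidity_block_lower_bound (n' p : ℕ) (hp : 1 ≤ p)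
    (M : Matrix (Fin n') (Fin n') ℝ) (r : ℕ) :
    p ^ 2 * Rig M r ≤
      Rig (Matrix.reindex finProdFinEquiv finProdFinEquiv
        (((fun _ _ => (1 : ℝ)) : Matrix (Fin p) (Fin p) ℝ) ⊗ₖ M)) r := by
  obtain ⟨S, hS, hcard⟩ := exists_sparsity_eq_rig (Matrix.reindex finProdFinEquiv finProdFinEquiv
    (((fun _ _ => (1 : ℝ)) : Matrix (Fin p) (Fin p) ℝ) ⊗ₖ M)) r
  rw [← hcard, ← sparsity_submatrix_equiv S finProdFinEquiv finProdFinEquiv,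
    sparsity_eq_sum_blocks]
  have hblock (a b : Fin p) : Rig M r ≤ sparsity ((S.submatrix finProdFinEquiv
      finProdFinEquiv).submatrix (Prod.mk a) (Prod.mk b)) := by
    refine rig_le_sparsity (le_trans ?_ hS)
    refine le_of_eq_of_le (congrArg Matrix.rank ?_) (Matrix.rank_submatrix_le _
      (fun i : Fin n' => finProdFinEquiv (a, i)) (fun j : Fin n' => finProdFinEquiv (b, j)))
    ext i j
    simp only [Matrix.sub_apply, Matrix.submatrix_apply, Matrix.reindex_apply,
      Equiv.symm_apply_apply]
    exact congrArg (· - _) (one_mul (M i j)).symm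
  calc p ^ 2 * Rig M r = ∑ _a : Fin p, ∑ _b : Fin p, Rig M r := by
        simp [sq, mul_assoc]
    _ ≤ _ := Finset.sum_le_sum fun a _ => Finset.sum_le_sum fun b _ => hblock a b
end

section
/- Let r ≥ 1 and p ≥ 1 be integers. If n ≥ p·(r(⌈(r+1)/2⌉ + 1) + 1), then the set LS_n(r, p²·r) of n×n real matrices is not closed in the Euclidean topology on ℝ^{n×n}. -/
open Matrix

open Filter Topology

/-- The rows of `simplexRows r` are `r + 1` vectors in `ℝ^r` any `r` of which are linearly
independent: the standard basis together with minus its sum. -/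
def simplexRows (r : ℕ) : Matrix (Option (Fin r)) (Fin r) ℝ :=
  fun i j => (if i = some j then 1 else 0) - (if i = none then 1 else 0)

lemma simplexRows_exists_right_inverse {r : ℕ} (X : Finset (Option (Fin r))) (hX : X.card ≤ r) :
    ∃ R : Matrix (Fin r) X ℝ, (simplexRows r).submatrix (Subtype.val : X → _) id * R = 1 := by
  obtain ⟨k, hk⟩ : ∃ k, k ∉ X := by
    by_contra! h
    have hc := Finset.card_le_card (fun k _ => h k : Finset.univ ⊆ X)
    simp at hc
    omega
  refine ⟨of fun i j => (if j.1 = some i then 1 else 0) - (if k = some i then 1 else 0), ?_⟩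
  ext ⟨i, hi⟩ ⟨j, hj⟩
  have hik : i ≠ k := fun h => hk (h ▸ hi)
  have key : ∀ a : Option (Fin r), ∑ l, simplexRows r i l * (if a = some l then 1 else 0)
      = (if i = a then 1 else 0) - (if i = none then 1 else 0) := by
    rintro (_ | a)
    · simp
    · simp [simplexRows]
  simp only [Matrix.mul_apply, Matrix.submatrix_apply, of_apply, id, mul_sub, Finset.sum_sub_distrib, key,
    Matrix.one_apply, Subtype.mk.injEq, hik]
  simp

lemma card_add_card_le_rank_fromBlocks {l m a b : Type*} [Fintype l] [Fintype m] [Fintype a]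
    [Fintype b] [DecidableEq a] [DecidableEq b] {A : Matrix a l ℝ} {D : Matrix m l ℝ}
    {B : Matrix m b ℝ} {R : Matrix l a ℝ} {Q : Matrix b m ℝ} (hR : A * R = 1) (hQ : Q * B = 1) :
    Fintype.card a + Fintype.card b ≤ (fromBlocks A 0 D B).rank := by
  have h : fromBlocks (1 : Matrix a a ℝ) 0 0 Q * fromBlocks A 0 D B *
      fromBlocks R 0 0 (1 : Matrix b b ℝ) = fromBlocks 1 0 (Q * D * R) 1 := by
    simp [fromBlocks_multiply, hR, hQ]
  have hu : IsUnit (fromBlocks (1 : Matrix a a ℝ) 0 (Q * D * R) (1 : Matrix b b ℝ)) := by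
    rw [Matrix.isUnit_iff_isUnit_det, det_fromBlocks_zero₁₂]
    simp
  calc Fintype.card a + Fintype.card b = Fintype.card (a ⊕ b) := Fintype.card_sum.symm
    _ = _ := (rank_of_isUnit _ hu).symm
    _ ≤ _ := by rw [← h]; exact (rank_mul_le_left _ _).trans (rank_mul_le_right _ _)

lemma card_add_card_le_sparsity {m l : Type*} [Fintype m] [Fintype l]
    {S : Matrix (m ⊕ l) (m ⊕ l) ℝ} {X Y : Finset l} (hX : ∀ j ∈ X, ∃ y, S (.inr j) y ≠ 0)
    (hY : ∀ j ∈ Y, ∃ i, S (.inl i) (.inr j) ≠ 0) : X.card + Y.card ≤ sparsity S := by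
  have hx : ∀ j : X, ∃ y, S (.inr j.1) y ≠ 0 := fun j => hX j.1 j.2
  have hy : ∀ j : Y, ∃ i, S (.inl i) (.inr j.1) ≠ 0 := fun j => hY j.1 j.2
  choose f hf using hx
  choose g hg using hy
  let F : X ⊕ Y → {q : (m ⊕ l) × (m ⊕ l) // S q.1 q.2 ≠ 0} :=
    Sum.elim (fun j => ⟨(.inr j.1, f j), hf j⟩) (fun j => ⟨(.inl (g j), .inr j.1), hg j⟩)
  have hF : Function.Injective F := by
    rintro (⟨i, hi⟩ | ⟨i, hi⟩) (⟨j, hj⟩ | ⟨j, hj⟩) hij <;> simp [F] at hij ⊢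
    · exact hij.1
    · exact hij.2
  have := Nat.card_le_card_of_injective F hF
  rw [Nat.card_sum, Nat.card_eq_fintype_card, Nat.card_eq_fintype_card, Fintype.card_coe,
    Fintype.card_coe] at this
  exact this

lemma lt_rank_of_sparsity_le {r : ℕ} (hr : 1 ≤ r)
    {L S : Matrix (Fin r ⊕ Option (Fin r)) (Fin r ⊕ Option (Fin r)) ℝ}
    (h : fromBlocks 0 (simplexRows r)ᵀ (simplexRows r) 0 = L + S) (hS : sparsity S ≤ r) :
    r < L.rank := by
  classical
  let X : Finset (Option (Fin r)) := {j | ∃ y, S (.inr j) y ≠ 0}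
  let Y : Finset (Option (Fin r)) := {j | ∃ i, S (.inl i) (.inr j) ≠ 0}
  have hX : ∀ j, j ∈ X ↔ ∃ y, S (.inr j) y ≠ 0 := fun j => Finset.mem_filter_univ j
  have hY : ∀ j, j ∈ Y ↔ ∃ i, S (.inl i) (.inr j) ≠ 0 := fun j => Finset.mem_filter_univ j
  clear_value X Y
  have hXY := (card_add_card_le_sparsity (fun j => (hX j).1) (fun j => (hY j).1)).trans hS
  have hcard : Fintype.card (Option (Fin r)) = r + 1 := by simp
  have hXc := Finset.card_add_card_compl X
  have hYc := Finset.card_add_card_compl Y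
  obtain ⟨X', hX', hX'c⟩ := Finset.exists_subset_card_eq (min_le_right r Xᶜ.card)
  obtain ⟨Y', hY', hY'c⟩ := Finset.exists_subset_card_eq (min_le_right r Yᶜ.card)
  obtain ⟨R, hR⟩ := simplexRows_exists_right_inverse X' (by omega)
  obtain ⟨Q, hQ⟩ := simplexRows_exists_right_inverse Y' (by omega)
  have hQ' : Qᵀ * ((simplexRows r).submatrix (Subtype.val : Y' → _) id)ᵀ = 1 := by
    rw [← transpose_mul, hQ, transpose_one]
  have hsub : L.submatrix (Sum.elim (fun j : X' => .inr j.1) .inl)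
      (Sum.elim .inl (fun j : Y' => .inr j.1)) =
      fromBlocks ((simplexRows r).submatrix (Subtype.val : X' → _) id) 0
        L.toBlocks₁₁ ((simplexRows r).submatrix (Subtype.val : Y' → _) id)ᵀ := by
    have hX0 : ∀ j ∈ X', ∀ y, S (.inr j) y = 0 := fun j hj => by simpa [hX] using hX' hj
    have hY0 : ∀ j ∈ Y', ∀ i, S (.inl i) (.inr j) = 0 := fun j hj => by simpa [hY] using hY' hj
    ext (⟨i, hi⟩ | i) (j | ⟨j, hj⟩)
    · simpa [hX0 i hi] using (congr_fun₂ h (.inr i) (.inl j)).symm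
    · simpa [hX0 i hi] using (congr_fun₂ h (.inr i) (.inr j)).symm
    · rfl
    · simpa [hY0 j hj] using (congr_fun₂ h (.inl i) (.inr j)).symm
  have hrank := card_add_card_le_rank_fromBlocks (D := L.toBlocks₁₁) hR hQ'
  rw [← hsub, Fintype.card_coe, Fintype.card_coe] at hrank
  have := hrank.trans (rank_submatrix_le L _ _)
  omega

lemma exists_sparsity_submatrix_le {I m : Type*} [Fintype I] [Fintype m] {p s : ℕ} (hp : 1 ≤ p)
    {e : Fin p × I → m} (he : Function.Injective e) {S : Matrix m m ℝ}
    (hS : sparsity S ≤ p ^ 2 * s) :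
    ∃ a b, sparsity (S.submatrix (fun i => e (a, i)) (fun i => e (b, i))) ≤ s := by
  by_contra! h
  let T := fun ab : Fin p × Fin p => {q : I × I // S (e (ab.1, q.1)) (e (ab.2, q.2)) ≠ 0}
  let F : (Σ ab, T ab) → {q : m × m // S q.1 q.2 ≠ 0} :=
    fun t => ⟨(e (t.1.1, t.2.1.1), e (t.1.2, t.2.1.2)), t.2.2⟩
  have hF : Function.Injective F := by
    rintro ⟨⟨a, b⟩, ⟨⟨i, j⟩, h1⟩⟩ ⟨⟨a', b'⟩, ⟨⟨i', j'⟩, h2⟩⟩ hab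
    simp only [F, Subtype.mk.injEq, Prod.mk.injEq] at hab
    obtain ⟨h3, h4⟩ := hab
    have h3 := he h3
    have h4 := he h4
    simp only [Prod.mk.injEq] at h3 h4
    obtain ⟨rfl, rfl⟩ := h3
    obtain ⟨rfl, rfl⟩ := h4
    rfl
  have hc := Nat.card_le_card_of_injective F hF
  rw [Nat.card_sigma] at hc
  have hlow : ∑ _ab : Fin p × Fin p, (s + 1) ≤ ∑ ab, Nat.card (T ab) :=
    Finset.sum_le_sum fun ab _ => h ab.1 ab.2
  simp only [Finset.sum_const, Finset.card_univ, Fintype.card_prod, Fintype.card_fin,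
    smul_eq_mul] at hlow
  have := (hlow.trans hc).trans hS
  nlinarith

lemma sparsity_mul_transpose_le {I m : Type*} [Fintype m] {p r : ℕ} {e : Fin p × I → m}
    {E : Matrix m (Fin r) ℝ} {f : Fin r → I} (hE : ∀ x i, E x i ≠ 0 → ∃ a, e (a, f i) = x)
    (c : ℝ) : sparsity (c • (E * Eᵀ)) ≤ p ^ 2 * r := by
  classical
  let F : Fin r × Fin p × Fin p → m × m := fun t => (e (t.2.1, f t.1), e (t.2.2, f t.1))
  have hsub : {q : m × m | (c • (E * Eᵀ)) q.1 q.2 ≠ 0} ⊆ Set.range F := by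
    rintro ⟨x, y⟩ hxy
    have hne : ∑ i, E x i * E y i ≠ 0 := by
      intro h0
      exact hxy (by simp [Matrix.mul_apply, h0])
    obtain ⟨i, -, hi⟩ := Finset.exists_ne_zero_of_sum_ne_zero hne
    obtain ⟨a, ha⟩ := hE x i (left_ne_zero_of_mul hi)
    obtain ⟨b, hb⟩ := hE y i (right_ne_zero_of_mul hi)
    exact ⟨(i, a, b), by simp [F, ha, hb]⟩
  calc sparsity (c • (E * Eᵀ)) ≤ Nat.card (Set.range F) := Nat.card_mono (Set.toFinite _) hsub
    _ ≤ Nat.card (Fin r × Fin p × Fin p) := Finite.card_range_le F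
    _ = p ^ 2 * r := by simp; ring

lemma mul_transpose_add_mem_closure_LS {n r s : ℕ} (E W : Matrix (Fin n) (Fin r) ℝ)
    (hE : ∀ c : ℝ, sparsity (c • (E * Eᵀ)) ≤ s) :
    E * Wᵀ + W * Eᵀ ∈ closure (LS n n r s) := by
  have hlim : Tendsto (fun t : ℝ => E * Wᵀ + W * Eᵀ + t • (W * Wᵀ)) (𝓝[≠] 0)
      (𝓝 (E * Wᵀ + W * Eᵀ)) := by
    have hc : Continuous fun t : ℝ => E * Wᵀ + W * Eᵀ + t • (W * Wᵀ) := by fun_prop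
    simpa using (hc.tendsto 0).mono_left nhdsWithin_le_nhds
  refine mem_closure_of_tendsto hlim ?_
  filter_upwards [self_mem_nhdsWithin] with t ht
  have ht : t ≠ 0 := ht
  refine ⟨(t⁻¹ • (E + t • W)) * (E + t • W)ᵀ, (-t⁻¹) • (E * Eᵀ), ?_, ?_, hE _⟩
  · simp only [transpose_add, transpose_smul, Matrix.add_mul, Matrix.mul_add, Matrix.smul_mul,
      Matrix.mul_smul, smul_add, smul_smul, neg_smul, inv_mul_cancel₀ ht, mul_inv_cancel₀ ht,
      one_smul]
    abel
  · exact (rank_mul_le_left _ _).trans (rank_le_width _)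

/-- For `r ≥ 1`, `p ≥ 1`, if `n ≥ p(r(⌈(r+1)/2⌉ + 1) + 1)` then `LS_n(r, p² r)`
is not closed. -/
theorem LS_not_closed_quadratic (n r p : ℕ) (hr : 1 ≤ r) (hp : 1 ≤ p)
    (hn : p * (r * (⌈((r : ℚ) + 1) / 2⌉₊ + 1) + 1) ≤ n) :
    ¬ IsClosed (LS n n r (p ^ 2 * r)) := by
  intro hclosed
  have hceil : 1 ≤ ⌈((r : ℚ) + 1) / 2⌉₊ := Nat.ceil_pos.mpr (by positivity)
  have hcard : Fintype.card (Fin p × (Fin r ⊕ Option (Fin r))) ≤ Fintype.card (Fin n) := by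
    simp only [Fintype.card_prod, Fintype.card_fin, Fintype.card_sum, Fintype.card_option]
    refine le_trans (Nat.mul_le_mul_left p ?_) hn
    nlinarith
  obtain ⟨e⟩ := Function.Embedding.nonempty_of_card_le hcard
  let E : Matrix (Fin n) (Fin r) ℝ :=
    Function.extend e (fun q => fromRows (1 : Matrix (Fin r) (Fin r) ℝ)
      (0 : Matrix (Option (Fin r)) (Fin r) ℝ) q.2) 0
  let W : Matrix (Fin n) (Fin r) ℝ :=
    Function.extend e (fun q => fromRows (0 : Matrix (Fin r) (Fin r) ℝ) (simplexRows r) q.2) 0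
  have hEe : ∀ q, E (e q) = fromRows (1 : Matrix (Fin r) (Fin r) ℝ)
      (0 : Matrix (Option (Fin r)) (Fin r) ℝ) q.2 :=
    fun q => e.injective.extend_apply _ _ q
  have hWe : ∀ q, W (e q) = fromRows (0 : Matrix (Fin r) (Fin r) ℝ) (simplexRows r) q.2 :=
    fun q => e.injective.extend_apply _ _ q
  have hE : ∀ x i, E x i ≠ 0 → ∃ a, e (a, Sum.inl i) = x := by
    intro x i hx
    by_cases hq : ∃ q, e q = x
    · obtain ⟨⟨a, j | j⟩, rfl⟩ := hq
      · rw [hEe] at hx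
        have hji : j = i := by
          by_contra hji
          exact hx (one_apply_ne hji)
        exact ⟨a, by rw [hji]⟩
      · rw [hEe] at hx
        exact absurd rfl hx
    · exact absurd (congr_fun (Function.extend_apply' _ _ _ hq) i) hx
  have hmem := mul_transpose_add_mem_closure_LS E W (sparsity_mul_transpose_le hE)
  rw [hclosed.closure_eq] at hmem
  obtain ⟨L, S, hLS, hL, hS⟩ := hmem
  obtain ⟨a, b, hab⟩ := exists_sparsity_submatrix_le hp e.injective hS
  refine (lt_rank_of_sparsity_le hr (L := L.submatrix (fun i => e (a, i)) (fun i => e (b, i)))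
    ?_ hab).not_ge ((rank_submatrix_le L _ _).trans hL)
  ext i j
  have h := congr_fun₂ hLS (e (a, i)) (e (b, j))
  simp only [Matrix.add_apply, Matrix.mul_apply, transpose_apply, hEe, hWe] at h
  rw [Matrix.add_apply, submatrix_apply, submatrix_apply, ← h]
  rcases i with i | i <;> rcases j with j | j <;> simp [one_apply]
end

section
/- The set LS_3(1,1) of 3×3 real matrices is not closed in the Euclidean topology on ℝ^{3×3}. -/
open Matrix

/-- All `2 × 2` minors of a matrix of rank at most one vanish. -/
theorem minor_eq_of_rank_le_one {m n : ℕ} {L : Matrix (Fin m) (Fin n) ℝ} (hL : L.rank ≤ 1)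
    (i i' : Fin m) (j j' : Fin n) : L i j * L i' j' = L i j' * L i' j := by
  by_contra h
  have hdet : IsUnit (L.submatrix ![i, i'] ![j, j']).det := by
    rw [isUnit_iff_ne_zero, Matrix.det_fin_two]
    simpa [sub_eq_zero] using h
  have h2 := Matrix.rank_of_isUnit _ ((Matrix.isUnit_iff_isUnit_det _).2 hdet)
  have h1 := Matrix.rank_submatrix_le L ![i, i'] ![j, j']
  rw [Fintype.card_fin] at h2
  omega

/-- A matrix of sparsity at most one has at most one nonzero entry. -/
theorem eq_zero_or_eq_zero_of_sparsity_le_one {I J : Type*} [Fintype I] [Fintype J]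
    {S : Matrix I J ℝ} (hS : sparsity S ≤ 1) (i i' : I) (j j' : J) (h : (i, j) ≠ (i', j')) :
    S i j = 0 ∨ S i' j' = 0 := by
  by_contra! hne
  have := Finite.card_le_one_iff_subsingleton.1 hS
  exact h (congrArg Subtype.val (Subsingleton.elim
    (⟨(i, j), hne.1⟩ : {p : I × J // S p.1 p.2 ≠ 0}) ⟨(i', j'), hne.2⟩))

theorem arrow_notMem_LS : !![0, 1, 1; 1, 0, 0; 1, 0, 0] ∉ LS 3 3 1 1 := by
  rintro ⟨L, S, hM, hL, hS⟩
  have hmin := minor_eq_of_rank_le_one hL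
  have hz := eq_zero_or_eq_zero_of_sparsity_le_one hS
  have e (i j : Fin 3) := congrFun (congrFun hM i) j
  have e00 : 0 = L 0 0 + S 0 0 := e 0 0
  have e01 : 1 = L 0 1 + S 0 1 := e 0 1
  have e02 : 1 = L 0 2 + S 0 2 := e 0 2
  have e10 : 1 = L 1 0 + S 1 0 := e 1 0
  have e20 : 1 = L 2 0 + S 2 0 := e 2 0
  have e11 : 0 = L 1 1 + S 1 1 := e 1 1
  have m11 := hmin 0 1 0 1
  have m12 := hmin 0 1 0 2
  have m21 := hmin 0 2 0 1
  have m22 := hmin 0 2 0 2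
  have z1 := hz 0 1 0 0 (by decide)
  have z2 := hz 0 0 0 1 (by decide)
  have z3 := hz 0 1 0 1 (by decide)
  have z4 := hz 0 0 1 2 (by decide)
  have z5 := hz 1 2 0 0 (by decide)
  have z6 := hz 0 1 1 0 (by decide)
  grind

theorem perturbed_arrow_mem_LS {t : ℝ} (ht : t ≠ 0) :
    !![0, 1, 1; 1, t, t; 1, t, t] ∈ LS 3 3 1 1 := by
  refine ⟨Matrix.vecMulVec ![t⁻¹, 1, 1] ![1, t, t], Matrix.single 0 0 (-t⁻¹), ?_,
    Matrix.rank_vecMulVec_le _ _, ?_⟩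
  · ext i j
    fin_cases i <;> fin_cases j <;> simp [ht]
  · refine Finite.card_le_one_iff_subsingleton.2 ⟨fun p q => Subtype.ext ?_⟩
    have key : ∀ p : {p : Fin 3 × Fin 3 // Matrix.single 0 0 (-t⁻¹) p.1 p.2 ≠ 0},
        p.1 = (0, 0) := by
      rintro ⟨⟨i, j⟩, hp⟩
      by_contra h
      exact hp (Matrix.single_apply_of_ne _ _ _ _ _ fun h' => h (Prod.ext h'.1.symm h'.2.symm))
    rw [key p, key q]

/-- The set `LS_3(1,1)` of 3×3 real matrices is not closed. -/
theorem LS_three_one_one_not_closed : ¬ IsClosed (LS 3 3 1 1) := by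
  intro hclosed
  have hcont : Continuous fun t : ℝ => !![0, 1, 1; 1, t, t; 1, t, t] := by
    refine continuous_matrix fun i j => ?_
    fin_cases i <;> fin_cases j <;> simp <;> fun_prop
  have hsub : closure {0}ᶜ ⊆ (fun t : ℝ => !![0, 1, 1; 1, t, t; 1, t, t]) ⁻¹' LS 3 3 1 1 :=
    (hclosed.preimage hcont).closure_subset_iff.2 fun _ ht => perturbed_arrow_mem_LS ht
  exact arrow_notMem_LS (hsub (dense_compl_singleton (0 : ℝ) 0))
end

section
/- Consider the 3×3 matrix completion instance where all entries of M with rows (0,1,1), (1,0,0), (1,0,0) are observed except the (1,1) entry. Then: (i) for every x ∈ ℝ, the matrix with rows (x,1,1), (1,0,0), (1,0,0) has rank at least 2, so no completion of rank ≤ 1 exists; and (ii) for every δ > 0 there exists a matrix L ∈ ℝ^{3×3} of rank at most 1 agreeing with M to within δ (in absolute value) on every entry except the (1,1) entry, so the infimum of the observed-entry residual over rank ≤ 1 matrices equals 0. -/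
open Matrix

/-- Matrix completion instance: `M` has rows `(0,1,1), (1,0,0), (1,0,0)` and all
entries except the `(1,1)` (top-left) entry are observed. (i) No choice of the
missing entry gives a matrix of rank `≤ 1`; (ii) yet for every `δ > 0` there is a
rank `≤ 1` matrix agreeing with `M` to within `δ` on every observed entry, so the
infimum of the observed-entry residual over rank `≤ 1` matrices is `0`. -/
theorem matrix_completion_ill_posed :
    (∀ x : ℝ,
      2 ≤ (!![x, 1, 1; 1, 0, 0; 1, 0, 0] : Matrix (Fin 3) (Fin 3) ℝ).rank) ∧
    (∀ δ : ℝ, 0 < δ → ∃ L : Matrix (Fin 3) (Fin 3) ℝ, L.rank ≤ 1 ∧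
      ∀ i j : Fin 3, (i, j) ≠ ((0 : Fin 3), (0 : Fin 3)) →
        |L i j - (!![0, 1, 1; 1, 0, 0; 1, 0, 0] : Matrix (Fin 3) (Fin 3) ℝ) i j| ≤ δ) := by
  refine ⟨fun x => ?_, fun δ hδ => ?_⟩
  · have hdet : IsUnit (!![x, 1; 1, 0] : Matrix (Fin 2) (Fin 2) ℝ) := by
      rw [Matrix.isUnit_iff_isUnit_det]
      simp [Matrix.det_fin_two_of]
    calc 2 = (!![x, 1; 1, 0] : Matrix (Fin 2) (Fin 2) ℝ).rank := by
          simp [Matrix.rank_of_isUnit _ hdet]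
      _ = ((!![x, 1, 1; 1, 0, 0; 1, 0, 0] : Matrix (Fin 3) (Fin 3) ℝ).submatrix
            ![0, 1] ![0, 1]).rank := by
          congr 1
          ext i j
          fin_cases i <;> fin_cases j <;> rfl
      _ ≤ _ := Matrix.rank_submatrix_le _ _ _
  · refine ⟨Matrix.vecMulVec ![1, δ, δ] ![δ⁻¹, 1, 1], Matrix.rank_vecMulVec_le _ _, ?_⟩
    intro i j hij
    fin_cases i <;> fin_cases j <;>
      simp_all [Matrix.vecMulVec_apply, hδ.ne', abs_of_pos hδ, hδ.le]
end

section
/- The set LS_3(1,3) of 3×3 real matrices is not closed in the Euclidean topology on ℝ^{3×3}. -/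
open Matrix

/-- A real matrix of rank at most one has multiplicative entries. -/
theorem exists_entry_eq_mul_of_rank_le_one {m n : Type*} [Fintype n]
    [DecidableEq n] [Finite m] {L : Matrix m n ℝ} (h : L.rank ≤ 1) :
    ∃ (u : m → ℝ) (v : n → ℝ), ∀ i j, L i j = u i * v j := by
  rw [Matrix.rank, finrank_le_one_iff] at h
  obtain ⟨w, hw⟩ := h
  have hcol : ∀ j, ∃ c : ℝ, ∀ i, L i j = w.1 i * c := by
    intro j
    obtain ⟨c, hc⟩ := hw ⟨L.mulVecLin (Pi.single j 1), LinearMap.mem_range_self _ _⟩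
    refine ⟨c, fun i => ?_⟩
    have := congrFun (congrArg Subtype.val hc) i
    simp at this
    rw [← this, mul_comm]
  choose v hv using hcol
  exact ⟨w.1, v, fun i j => hv j i⟩

/-- Three positions of a `3 × 3` grid either miss all four corners of some rectangle or are
contained in the graph of a permutation. -/
theorem exists_rectangle_or_perm_of_card_le_three :
    ∀ T : Finset (Fin 3 × Fin 3), T.card ≤ 3 →
      (∃ i k j l : Fin 3, i < k ∧ j < l ∧
        (i, j) ∉ T ∧ (i, l) ∉ T ∧ (k, j) ∉ T ∧ (k, l) ∉ T) ∨
      ∃ σ : Equiv.Perm (Fin 3), ∀ i j, (i, j) ∈ T → σ i = j := by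
  set_option maxRecDepth 100000 in decide

/-- A limit point of `LS 3 3 1 3` outside that set. -/
def limitMatrix : Matrix (Fin 3) (Fin 3) ℝ := !![1, 0, 1; 0, 2, 1; 1, 1, 3]

theorem limitMatrix_minor_ne_zero {i k j l : Fin 3} (hik : i < k) (hjl : j < l) :
    limitMatrix i j * limitMatrix k l ≠ limitMatrix i l * limitMatrix k j := by
  fin_cases i <;> fin_cases k <;> first | exact absurd hik (by decide) | skip
  all_goals fin_cases j <;> fin_cases l <;> first | exact absurd hjl (by decide) | skip
  all_goals norm_num [limitMatrix]

theorem limitMatrix_notMem_LS : limitMatrix ∉ LS 3 3 1 3 := by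
  rintro ⟨L, S, hM, hL, hS⟩
  obtain ⟨u, v, huv⟩ := exists_entry_eq_mul_of_rank_le_one hL
  classical
  have hcard : (Finset.univ.filter fun p : Fin 3 × Fin 3 => S p.1 p.2 ≠ 0).card ≤ 3 := by
    rwa [sparsity, Nat.card_eq_fintype_card, Fintype.card_subtype] at hS
  have hentry : ∀ i j, S i j = 0 → limitMatrix i j = u i * v j := by
    intro i j h
    rw [hM, Matrix.add_apply, h, add_zero, huv]
  rcases exists_rectangle_or_perm_of_card_le_three _ hcard with
    ⟨i, k, j, l, hik, hjl, h₁, h₂, h₃, h₄⟩ | ⟨σ, hσ⟩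
  · simp only [Finset.mem_filter, Finset.mem_univ, true_and, not_not] at h₁ h₂ h₃ h₄
    apply limitMatrix_minor_ne_zero hik hjl
    rw [hentry _ _ h₁, hentry _ _ h₂, hentry _ _ h₃, hentry _ _ h₄]
    ring
  · have hoff : ∀ i j, σ i ≠ j → limitMatrix i j = u i * v j := by
      intro i j h
      apply hentry
      by_contra hne
      exact h (hσ i j (by simpa using hne))
    clear hσ hentry
    have h00 := hoff 0 0
    have h01 := hoff 0 1
    have h02 := hoff 0 2
    have h10 := hoff 1 0
    have h11 := hoff 1 1
    have h12 := hoff 1 2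
    have h20 := hoff 2 0
    have h21 := hoff 2 1
    have h22 := hoff 2 2
    have inj01 : σ 0 ≠ σ 1 := σ.injective.ne (by decide)
    have inj02 : σ 0 ≠ σ 2 := σ.injective.ne (by decide)
    have inj12 : σ 1 ≠ σ 2 := σ.injective.ne (by decide)
    generalize σ 0 = a at *
    generalize σ 1 = b at *
    generalize σ 2 = c at *
    simp only [limitMatrix, Matrix.of_apply, Matrix.cons_val] at h00 h01 h02 h10 h11 h12 h20 h21 h22
    clear hoff hcard hM hL hS huv
    fin_cases a <;> fin_cases b <;> first | exact absurd rfl inj01 | skip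
    all_goals fin_cases c <;> first | exact absurd rfl inj02 | exact absurd rfl inj12 | skip
    all_goals simp at h00 h01 h02 h10 h11 h12 h20 h21 h22
    all_goals grind

theorem limitMatrix_add_mem_LS {ε : ℝ} (hε : ε ≠ 0) :
    limitMatrix + ε • !![0, 1, 0; 1, 0, 0; 0, 0, 0] ∈ LS 3 3 1 3 := by
  refine ⟨Matrix.vecMulVec ![1, 1, ε⁻¹] ![ε, ε, 1],
    Matrix.diagonal ![1 - ε, 2 - ε, 3 - ε⁻¹], ?_, Matrix.rank_vecMulVec_le _ _, ?_⟩
  · ext i j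
    fin_cases i <;> fin_cases j <;>
      simp [limitMatrix, hε]
  · have hinj : Function.Injective
        (fun p : {p : Fin 3 × Fin 3 //
          Matrix.diagonal ![1 - ε, 2 - ε, 3 - ε⁻¹] p.1 p.2 ≠ 0} => p.1.1) := by
      rintro ⟨⟨i, j⟩, h⟩ ⟨⟨k, l⟩, h'⟩ (rfl : i = k)
      have hij : i = j := by
        by_contra hne
        exact h (Matrix.diagonal_apply_ne _ hne)
      have hil : i = l := by
        by_contra hne
        exact h' (Matrix.diagonal_apply_ne _ hne)
      subst hij hil
      rfl
    simpa [sparsity] using Nat.card_le_card_of_injective _ hinj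

/-- The set `LS_3(1,3)` of 3×3 real matrices is not closed. -/
theorem LS_three_one_three_not_closed : ¬ IsClosed (LS 3 3 1 3) := by
  intro hclosed
  have hcont : Continuous fun ε : ℝ =>
      limitMatrix + ε • (!![0, 1, 0; 1, 0, 0; 0, 0, 0] : Matrix (Fin 3) (Fin 3) ℝ) := by
    fun_prop
  have hlim := (hcont.tendsto 0).mono_left (nhdsWithin_le_nhds (s := {0}ᶜ))
  rw [zero_smul, add_zero] at hlim
  refine limitMatrix_notMem_LS (hclosed.mem_of_tendsto hlim ?_)
  filter_upwards [self_mem_nhdsWithin] with ε hε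
  exact limitMatrix_add_mem_LS hε
end

section
/- For any real numbers a, b, c, d, e, g, i and any real ε ≠ 0, the 3×3 matrix M(ε) with rows (a, b, c), (d, e, ε·c·d), (g, ε·b·g, i) belongs to LS_3(1,3); indeed M(ε) is the sum of the rank ≤ 1 matrix with rows (ε⁻¹, b, c), (d, ε·b·d, ε·c·d), (g, ε·b·g, ε·c·g) and a diagonal matrix with at most 3 nonzero entries. -/
open Matrix

theorem sparsity_diagonal_le {n : ℕ} (v : Fin n → ℝ) :
    sparsity (Matrix.diagonal v) ≤ n := by
  have hinj : Function.Injective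
      (fun p : {p : Fin n × Fin n // Matrix.diagonal v p.1 p.2 ≠ 0} => p.1.1) := by
    have hdiag (p : {p : Fin n × Fin n // Matrix.diagonal v p.1 p.2 ≠ 0}) : p.1.1 = p.1.2 :=
      not_imp_comm.1 (Matrix.diagonal_apply_ne v) p.2
    intro p q h
    exact Subtype.ext (Prod.ext h ((hdiag p).symm.trans (h.trans (hdiag q))))
  simpa [sparsity] using Nat.card_le_card_of_injective _ hinj

/-- For any reals `a,b,c,d,e,g,i` and `ε ≠ 0`, the matrix `M(ε)` with rows
`(a,b,c), (d,e,εcd), (g,εbg,i)` belongs to `LS_3(1,3)`: indeed it is the sum of the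
rank ≤ 1 matrix with rows `(ε⁻¹,b,c), (d,εbd,εcd), (g,εbg,εcg)` and a diagonal
matrix with at most 3 nonzero entries. -/
theorem maximally_rigid_perturbation (a b c d e g i ε : ℝ) (hε : ε ≠ 0) :
    (!![a, b, c; d, e, ε * c * d; g, ε * b * g, i] : Matrix (Fin 3) (Fin 3) ℝ)
      ∈ LS 3 3 1 3 ∧
    (!![ε⁻¹, b, c; d, ε * b * d, ε * c * d; g, ε * b * g, ε * c * g] :
        Matrix (Fin 3) (Fin 3) ℝ).rank ≤ 1 ∧
    ∃ D : Matrix (Fin 3) (Fin 3) ℝ,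
      (∀ i' j' : Fin 3, i' ≠ j' → D i' j' = 0) ∧ sparsity D ≤ 3 ∧
      (!![a, b, c; d, e, ε * c * d; g, ε * b * g, i] : Matrix (Fin 3) (Fin 3) ℝ) =
        (!![ε⁻¹, b, c; d, ε * b * d, ε * c * d; g, ε * b * g, ε * c * g] :
          Matrix (Fin 3) (Fin 3) ℝ) + D := by
  have hrank : (!![ε⁻¹, b, c; d, ε * b * d, ε * c * d; g, ε * b * g, ε * c * g] :
      Matrix (Fin 3) (Fin 3) ℝ).rank ≤ 1 := by
    have h : (!![ε⁻¹, b, c; d, ε * b * d, ε * c * d; g, ε * b * g, ε * c * g] :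
        Matrix (Fin 3) (Fin 3) ℝ) =
          Matrix.vecMulVec ![ε⁻¹, d, g] ![1, ε * b, ε * c] := by
      ext j k
      fin_cases j <;> fin_cases k <;> simp [Matrix.vecMulVec_apply, hε] <;> ring
    rw [h]
    exact Matrix.rank_vecMulVec_le _ _
  have hsum : (!![a, b, c; d, e, ε * c * d; g, ε * b * g, i] : Matrix (Fin 3) (Fin 3) ℝ) =
      !![ε⁻¹, b, c; d, ε * b * d, ε * c * d; g, ε * b * g, ε * c * g] +
        Matrix.diagonal ![a - ε⁻¹, e - ε * b * d, i - ε * c * g] := by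
    ext j k
    fin_cases j <;> fin_cases k <;> simp
  have hcard := sparsity_diagonal_le ![a - ε⁻¹, e - ε * b * d, i - ε * c * g]
  exact ⟨⟨_, _, hsum, hrank, hcard⟩, hrank, _,
    fun _ _ h => Matrix.diagonal_apply_ne _ h, hcard, hsum⟩
end

section
/- Let r ≥ 1 and l ≥ 1 be integers, set k = ⌈l/r⌉ and n = r(l+1) + k. Let α, β ∈ ℝ^{r×k} be matrices all of whose entries are nonzero, and let A^{(1)}, …, A^{(l)}, B^{(1)}, …, B^{(l)} ∈ ℝ^{r×r} be invertible matrices. Define M ∈ ℝ^{n×n} as the block matrix, with row and column blocks of sizes (r, k, r, r, …, r), whose first block row is (0_{r,r}, β, A^{(1)}, …, A^{(l)}), whose first block column is (0_{r,r}; αᵀ; B^{(1)}; …; B^{(l)}), and all of whose remaining blocks are zero. Then Rig(M, r) ≥ 2l; that is, for every S ∈ ℝ^{n×n} with rank(M − S) ≤ r one has ‖S‖₀ ≥ 2l. -/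
open Matrix

/-- The rank of matrices is subadditive. -/
theorem rank_add_le_rank_add_rank {I J : Type*} [Fintype I] [Fintype J] (P Q : Matrix I J ℝ) :
    (P + Q).rank ≤ P.rank + Q.rank := by
  rw [Matrix.rank, Matrix.rank, Matrix.rank, Matrix.mulVecLin_add]
  exact (Submodule.finrank_mono (LinearMap.range_add_le _ _)).trans
    (Submodule.finrank_add_le_finrank_add_finrank _ _)

/-- A block matrix with invertible antidiagonal blocks and a zero lower-right block has full rank,
whatever its upper-left block is. -/
theorem rank_fromBlocks_antidiagonal {R : Type*} [Fintype R] [DecidableEq R]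
    (X A B : Matrix R R ℝ) (hA : IsUnit A) (hB : IsUnit B) :
    (Matrix.fromBlocks X A B 0).rank = 2 * Fintype.card R := by
  have h_swap : (Matrix.fromBlocks X A B 0).submatrix (Equiv.refl (R ⊕ R)) (Equiv.sumComm R R) =
      Matrix.fromBlocks A X 0 B := by
    ext (i | i) (j | j) <;> rfl
  rw [← Matrix.rank_submatrix _ (Equiv.refl (R ⊕ R)) (Equiv.sumComm R R), h_swap,
    Matrix.rank_of_isUnit, Fintype.card_sum, two_mul]
  rw [Matrix.isUnit_iff_isUnit_det] at hA hB ⊢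
  rw [Matrix.det_fromBlocks_zero₂₁]
  exact hA.mul hB

/-- If a matrix with zero lower-right block contains, in its first block row and first block
column, invertible square blocks indexed by `T`, then reducing its rank to the block size
requires changing at least `|T|` times the block size many entries. -/
theorem card_mul_card_le_sparsity {R T C : Type*} [Fintype R] [DecidableEq R] [Fintype T]
    [Fintype C] (e : T × R → C) (he : Function.Injective e)
    (M S : Matrix (R ⊕ C) (R ⊕ C) ℝ)
    (hA : ∀ t, IsUnit (Matrix.of fun i j => M (Sum.inl i) (Sum.inr (e (t, j)))))
    (hB : ∀ t, IsUnit (Matrix.of fun i j => M (Sum.inr (e (t, i))) (Sum.inl j)))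
    (h_zero : ∀ i j, M (Sum.inr i) (Sum.inr j) = 0)
    (hS : (M - S).rank ≤ Fintype.card R) :
    Fintype.card T * Fintype.card R ≤ sparsity S := by
  let f : T → R ⊕ R → R ⊕ C := fun t => Sum.map id fun i => e (t, i)
  let D : T → Matrix (R ⊕ R) (R ⊕ R) ℝ := fun t =>
    Matrix.fromBlocks 0 (Matrix.of fun i j => S (Sum.inl i) (Sum.inr (e (t, j))))
      (Matrix.of fun i j => S (Sum.inr (e (t, i))) (Sum.inl j))
      (Matrix.of fun i j => S (Sum.inr (e (t, i))) (Sum.inr (e (t, j))))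
  have h_block : ∀ t, Fintype.card R ≤ sparsity (D t) := by
    intro t
    have h_split : Matrix.fromBlocks (Matrix.of fun i j => (M - S) (Sum.inl i) (Sum.inl j))
        (Matrix.of fun i j => M (Sum.inl i) (Sum.inr (e (t, j))))
        (Matrix.of fun i j => M (Sum.inr (e (t, i))) (Sum.inl j)) 0 =
        (M - S).submatrix (f t) (f t) + D t := by
      ext (i | i) (j | j) <;> simp [f, D, h_zero]
    have h_full := rank_fromBlocks_antidiagonal
      (Matrix.of fun i j => (M - S) (Sum.inl i) (Sum.inl j)) _ _ (hA t) (hB t)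
    rw [h_split] at h_full
    have h_add := rank_add_le_rank_add_rank ((M - S).submatrix (f t) (f t)) (D t)
    have h_sub : ((M - S).submatrix (f t) (f t)).rank ≤ (M - S).rank :=
      Matrix.rank_submatrix_le _ _ _
    have h_rank := rank_le_sparsity (D t)
    omega
  have h_mem : ∀ t i j, D t i j ≠ 0 → S (f t i) (f t j) ≠ 0 := by
    rintro t (i | i) (j | j) <;> simp [D, f]
  let g : (Σ t, {p : (R ⊕ R) × (R ⊕ R) // D t p.1 p.2 ≠ 0}) →
      {p : (R ⊕ C) × (R ⊕ C) // S p.1 p.2 ≠ 0} :=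
    fun x => ⟨(f x.1 x.2.1.1, f x.1 x.2.1.2), h_mem _ _ _ x.2.2⟩
  have hg : Function.Injective g := by
    rintro ⟨t, ⟨p, q⟩, hp⟩ ⟨t', ⟨p', q'⟩, hp'⟩ h
    simp only [g, Subtype.mk.injEq, Prod.mk.injEq] at h
    obtain ⟨h₁, h₂⟩ := h
    have h_t : t = t' := by
      rcases p with p | p <;> rcases q with q | q <;> rcases p' with p' | p' <;>
        rcases q' with q' | q' <;> simp_all [f, D, he.eq_iff]
    subst h_t
    have hf : Function.Injective (f t) :=
      Sum.map_injective.2 ⟨Function.injective_id, fun i j hij => by simpa using he hij⟩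
    obtain rfl := hf h₁
    obtain rfl := hf h₂
    rfl
  calc Fintype.card T * Fintype.card R = ∑ _t : T, Fintype.card R := by simp
    _ ≤ ∑ t, sparsity (D t) := Finset.sum_le_sum fun t _ => h_block t
    _ = Nat.card (Σ t, {p : (R ⊕ R) × (R ⊕ R) // D t p.1 p.2 ≠ 0}) := Nat.card_sigma.symm
    _ ≤ sparsity S := Nat.card_le_card_of_injective g hg

/-- Rigidity lower bound for the construction of Lemma 2.  The matrix `M` is the
block matrix with row/column blocks of sizes `(r, k, r, …, r)` (so `M` is an
`n × n` matrix with `n = r(l+1) + k`), first block row `(0, β, A⁽¹⁾, …, A⁽ˡ⁾)`,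
first block column `(0; αᵀ; B⁽¹⁾; …; B⁽ˡ⁾)` and all remaining blocks zero, where
`α, β` have all entries nonzero and the `A⁽ᵗ⁾, B⁽ᵗ⁾` are invertible.  Then
`Rig(M, r) ≥ 2l`: every `S` with `rank (M − S) ≤ r` has at least `2l` nonzeros. -/
theorem rigidity_of_construction (r l : ℕ) (hr : 1 ≤ r) (hl : 1 ≤ l)
    (k : ℕ) (hk : k = ⌈(l : ℚ) / (r : ℚ)⌉₊)
    (α β : Matrix (Fin r) (Fin k) ℝ)
    (hα : ∀ i j, α i j ≠ 0) (hβ : ∀ i j, β i j ≠ 0)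
    (A B : Fin l → Matrix (Fin r) (Fin r) ℝ)
    (hA : ∀ t, IsUnit (A t)) (hB : ∀ t, IsUnit (B t)) :
    let M : Matrix (Fin r ⊕ (Fin k ⊕ Fin l × Fin r)) (Fin r ⊕ (Fin k ⊕ Fin l × Fin r)) ℝ :=
      fun i j =>
        match i, j with
        | Sum.inl i, Sum.inr (Sum.inl j) => β i j
        | Sum.inl i, Sum.inr (Sum.inr (t, j)) => A t i j
        | Sum.inr (Sum.inl i), Sum.inl j => α j i
        | Sum.inr (Sum.inr (t, i)), Sum.inl j => B t i j
        | _, _ => 0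
    2 * l ≤ Rig M r ∧
      ∀ S : Matrix (Fin r ⊕ (Fin k ⊕ Fin l × Fin r)) (Fin r ⊕ (Fin k ⊕ Fin l × Fin r)) ℝ,
        (M - S).rank ≤ r → 2 * l ≤ sparsity S := by
  intro M
  have h_bound : ∀ S : Matrix (Fin r ⊕ (Fin k ⊕ Fin l × Fin r)) (Fin r ⊕ (Fin k ⊕ Fin l × Fin r)) ℝ,
      (M - S).rank ≤ r → 2 * l ≤ sparsity S := by
    intro S hS
    have h_zero : ∀ i j, M (Sum.inr i) (Sum.inr j) = 0 := by
      rintro (i | i) (j | j) <;> rfl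
    obtain rfl | hr2 : r = 1 ∨ 2 ≤ r := by omega
    · have h_k : k = l := by simp [hk]
      have h_unit : ∀ N : Matrix (Fin 1) (Fin 1) ℝ, N 0 0 ≠ 0 → IsUnit N := fun N hN => by
        rw [Matrix.isUnit_iff_isUnit_det, Matrix.det_fin_one]
        exact hN.isUnit
      have h := card_mul_card_le_sparsity (R := Fin 1) (T := Fin k ⊕ Fin l)
        (fun p => p.1.map id fun t => (t, p.2)) ?_ M S ?_ ?_ h_zero (by simpa using hS)
      · simp only [Fintype.card_sum, Fintype.card_fin] at h
        omega
      · rintro ⟨s | s, i⟩ ⟨t | t, j⟩ h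
        · simpa [Subsingleton.elim i j] using h
        · simp at h
        · simp at h
        · simpa using h
      · rintro (j | t)
        · exact h_unit _ (hβ 0 j)
        · exact hA t
      · rintro (j | t)
        · exact h_unit _ (hα 0 j)
        · exact hB t
    · have h := card_mul_card_le_sparsity (R := Fin r) (T := Fin l) Sum.inr Sum.inr_injective M S
        hA hB h_zero (by simpa using hS)
      simp only [Fintype.card_fin] at h
      nlinarith
  refine ⟨le_csInf ⟨sparsity M, M, by simp, rfl⟩ ?_, h_bound⟩
  rintro _ ⟨S, hS, rfl⟩
  exact h_bound S hS
end
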